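/- arXiv:2403.10678 — 13 statements merged into one kernel-verified Lean document; each statement's English description precedes it below -/
import Mathlib

section
/- Let s > 0 and β > 1 + s. There exists N₀ (depending on s and β) such that for every integer N ≥ N₀, every set X with |X| = N², and every family 𝒮 of N-element subsets of X with |𝒮| ≤ N^{1+s}, there exists an N-element subset S' ⊆ X such that |S ∩ S'| ≤ β·(log N)/(log log N) for every S ∈ 𝒮. -/
open Filter Asymptotics

theorem Nat.descFactorial_sq_le (N k : ℕ) (hk : k ≤ N) :
    N.descFactorial k ^ 2 ≤ (N ^ 2).descFactorial k := by
  induction k with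
  | zero => simp
  | succ i ih =>
    have hi : i < N := hk
    rw [Nat.descFactorial_succ, Nat.descFactorial_succ, mul_pow]
    refine Nat.mul_le_mul ?_ (ih hi.le)
    obtain ⟨d, rfl⟩ := Nat.exists_eq_add_of_lt hi
    have h1 : i + d + 1 - i = d + 1 := by omega
    rw [h1]
    apply Nat.le_sub_of_add_le
    nlinarith [Nat.zero_le (i * d), Nat.zero_le (i * i)]

theorem Nat.factorial_mul_choose_sq_le (N k : ℕ) (hk : k ≤ N) :
    k.factorial * N.choose k ^ 2 ≤ (N ^ 2).choose k := by
  have h := Nat.descFactorial_sq_le N k hk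
  rw [Nat.descFactorial_eq_factorial_mul_choose,
    Nat.descFactorial_eq_factorial_mul_choose] at h
  have hpos := Nat.factorial_pos k
  refine Nat.le_of_mul_le_mul_left ?_ hpos
  calc k.factorial * (k.factorial * N.choose k ^ 2)
      = (k.factorial * N.choose k) ^ 2 := by ring
    _ ≤ _ := h

theorem Nat.mul_choose_mul_choose_lt (N k M : ℕ) (hk : k ≤ N) (hM : M < k.factorial) :
    M * (N.choose k * (N ^ 2 - k).choose (N - k)) < (N ^ 2).choose N := by
  have hN : N ≤ N ^ 2 := Nat.le_self_pow two_ne_zero N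
  have hmul : (N ^ 2).choose N * N.choose k = (N ^ 2).choose k * (N ^ 2 - k).choose (N - k) :=
    Nat.choose_mul hk
  have hsq := Nat.factorial_mul_choose_sq_le N k hk
  have hc : 0 < N.choose k := Nat.choose_pos hk
  have hd : 0 < (N ^ 2).choose N := Nat.choose_pos hN
  have he : 0 < (N ^ 2).choose k := Nat.choose_pos (hk.trans hN)
  refine Nat.lt_of_mul_lt_mul_left (a := (N ^ 2).choose k) ?_
  calc (N ^ 2).choose k * (M * (N.choose k * (N ^ 2 - k).choose (N - k)))
      = M * N.choose k * ((N ^ 2).choose k * (N ^ 2 - k).choose (N - k)) := by ring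
    _ = M * (N.choose k ^ 2 * (N ^ 2).choose N) := by rw [← hmul]; ring
    _ < k.factorial * (N.choose k ^ 2 * (N ^ 2).choose N) :=
        Nat.mul_lt_mul_of_pos_right hM (by positivity)
    _ = (k.factorial * N.choose k ^ 2) * (N ^ 2).choose N := by ring
    _ ≤ (N ^ 2).choose k * (N ^ 2).choose N := Nat.mul_le_mul_right _ hsq

theorem Finset.card_filter_le_card_inter_le {X : Type*} [Fintype X] [DecidableEq X]
    (S : Finset X) (n k : ℕ) :
    (((univ : Finset X).powersetCard n).filter (fun T => k ≤ (S ∩ T).card)).card ≤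
      S.card.choose k * (Fintype.card X - k).choose (n - k) := by
  have hsub : ((univ : Finset X).powersetCard n).filter (fun T => k ≤ (S ∩ T).card) ⊆
      (S.powersetCard k).biUnion
        (fun A => ((univ \ A).powersetCard (n - k)).image (fun B => A ∪ B)) := by
    intro T hT
    simp only [mem_filter, mem_powersetCard] at hT
    obtain ⟨⟨-, hTn⟩, hk⟩ := hT
    obtain ⟨A, hA, hAk⟩ := exists_subset_card_eq hk
    have hAS : A ⊆ S := hA.trans inter_subset_left
    have hAT : A ⊆ T := hA.trans inter_subset_right
    simp only [mem_biUnion, mem_image, mem_powersetCard]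
    refine ⟨A, ⟨hAS, hAk⟩, T \ A, ⟨sdiff_subset_sdiff (subset_univ T) subset_rfl, ?_⟩,
      union_sdiff_of_subset hAT⟩
    rw [card_sdiff_of_subset hAT, hTn, hAk]
  refine (card_le_card hsub).trans ?_
  rw [← card_powersetCard]
  refine card_biUnion_le_card_mul _ _ _ fun A hA => ?_
  refine card_image_le.trans ?_
  rw [card_powersetCard, card_sdiff_of_subset (subset_univ A), card_univ,
    (mem_powersetCard.1 hA).2]

theorem Finset.exists_card_eq_forall_card_inter_lt {X : Type*} [Fintype X] [DecidableEq X]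
    (𝒮 : Finset (Finset X)) (N k : ℕ) (hX : Fintype.card X = N ^ 2)
    (h𝒮 : ∀ S ∈ 𝒮, S.card = N) (hcard : 𝒮.card < k.factorial) :
    ∃ T : Finset X, T.card = N ∧ ∀ S ∈ 𝒮, (S ∩ T).card < k := by
  have hN : N ≤ N ^ 2 := Nat.le_self_pow two_ne_zero N
  rcases lt_or_ge N k with hk | hk
  · obtain ⟨T, -, hT⟩ := exists_subset_card_eq (s := (univ : Finset X)) (n := N)
      (by rwa [card_univ, hX])
    exact ⟨T, hT, fun S hS => ((card_le_card inter_subset_right).trans_eq hT).trans_lt hk⟩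
  by_contra! hbad
  have hsub : (univ : Finset X).powersetCard N ⊆ 𝒮.biUnion
      (fun S => ((univ : Finset X).powersetCard N).filter (fun T => k ≤ (S ∩ T).card)) := by
    intro T hT
    obtain ⟨S, hS, hST⟩ := hbad T (mem_powersetCard.1 hT).2
    exact mem_biUnion.2 ⟨S, hS, mem_filter.2 ⟨hT, hST⟩⟩
  have hle := (card_le_card hsub).trans
    (card_biUnion_le_card_mul _ _ (N.choose k * (N ^ 2 - k).choose (N - k)) fun S hS => by
      simpa only [h𝒮 S hS, hX] using card_filter_le_card_inter_le S N k)
  rw [card_powersetCard, card_univ, hX] at hle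
  exact (Nat.mul_choose_mul_choose_lt N k 𝒮.card hk hcard).not_ge hle

theorem Real.mul_log_sub_one_le_log_factorial (k : ℕ) (hk : 0 < k) :
    (k : ℝ) * (Real.log k - 1) ≤ Real.log k.factorial := by
  have hk' : (0 : ℝ) < k := by exact_mod_cast hk
  have hf : (0 : ℝ) < k.factorial := by exact_mod_cast k.factorial_pos
  have h := Real.log_le_log (by positivity) (Real.pow_div_factorial_le_exp (k : ℝ) hk'.le k)
  rw [Real.log_exp, Real.log_div (by positivity) hf.ne', Real.log_pow] at h
  linarith

theorem Real.eventually_mul_lt_mul_log_sub_one {a β : ℝ} (ha : 0 < a) (hβ : a < β) :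
    ∀ᶠ L : ℝ in atTop, 0 < L ∧ 0 < β * L / Real.log L ∧
      0 ≤ Real.log (β * L / Real.log L) - 1 ∧
      a * L < β * L / Real.log L * (Real.log (β * L / Real.log L) - 1) := by
  have hβ0 : 0 < β := ha.trans hβ
  set ε : ℝ := (β - a) / (4 * β) with hε
  have hε0 : 0 < ε := div_pos (by linarith) (by linarith)
  have hβε : β * ε = (β - a) / 4 := by rw [hε]; field_simp
  have hlog := Real.tendsto_log_atTop
  have h1 : ∀ᶠ y : ℝ in atTop, ‖Real.log y‖ ≤ ε * ‖y‖ := Real.isLittleO_log_id_atTop.bound hε0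
  filter_upwards [eventually_gt_atTop 0, hlog.eventually_gt_atTop 0, hlog.eventually h1,
    hlog.eventually_ge_atTop ((1 - Real.log β) / ε)] with L hL hy hy1 hy2
  set y := Real.log L with hydef
  have hlogx : Real.log (β * L / y) = Real.log β + y - Real.log y := by
    rw [Real.log_div (by positivity) hy.ne', Real.log_mul hβ0.ne' hL.ne']
  rw [Real.norm_of_nonneg hy.le] at hy1
  have hy1' : Real.log y ≤ ε * y := (le_abs_self _).trans hy1
  rw [div_le_iff₀ hε0] at hy2
  have hlow : (1 - 2 * ε) * y ≤ Real.log (β * L / y) - 1 := by rw [hlogx]; linarith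
  have hpos : a < β * (1 - 2 * ε) := by linarith
  have hfac : 0 < 1 - 2 * ε := pos_of_mul_pos_right (ha.trans hpos) hβ0.le
  have hx : 0 < β * L / y := by positivity
  refine ⟨hL, hx, (mul_pos hfac hy).le.trans hlow, ?_⟩
  calc a * L < β * (1 - 2 * ε) * L := mul_lt_mul_of_pos_right hpos hL
    _ = β * L / y * ((1 - 2 * ε) * y) := by field_simp
    _ ≤ _ := mul_le_mul_of_nonneg_left hlow hx.le

/-- For `s > 0` and `β > 1 + s`, for all large `N`, any family `𝒮` of
`N`-element subsets of a set `X` of size `N²` with `|𝒮| ≤ N^(1+s)` admits an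
`N`-element subset `S' ⊆ X` with `|S ∩ S'| ≤ β·log N / log log N` for all `S ∈ 𝒮`. -/
theorem stmt0 (s β : ℝ) (hs : 0 < s) (hβ : 1 + s < β) :
    ∃ N₀ : ℕ, ∀ N : ℕ, N₀ ≤ N →
      ∀ (X : Type) [Fintype X] [DecidableEq X] (𝒮 : Finset (Finset X)),
        Fintype.card X = N ^ 2 →
        (∀ S ∈ 𝒮, S.card = N) →
        (𝒮.card : ℝ) ≤ (N : ℝ) ^ ((1 : ℝ) + s) →
        ∃ S' : Finset X, S'.card = N ∧
          ∀ S ∈ 𝒮, ((S ∩ S').card : ℝ) ≤ β * Real.log N / Real.log (Real.log N) := by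
  have hev := (Real.tendsto_log_atTop.comp tendsto_natCast_atTop_atTop).eventually
    (Real.eventually_mul_lt_mul_log_sub_one (by linarith : 0 < 1 + s) hβ)
  obtain ⟨N₀, hN₀⟩ := eventually_atTop.1 (hev.and (eventually_gt_atTop (0 : ℕ)))
  refine ⟨N₀, fun N hN X _ _ 𝒮 hX h𝒮 hcard => ?_⟩
  obtain ⟨⟨-, hx, hlog, hlt⟩, hNpos⟩ := hN₀ N hN
  simp only [Function.comp_apply] at hx hlog hlt
  set x := β * Real.log N / Real.log (Real.log N) with hxdef
  have hN0 : (0 : ℝ) < N := by exact_mod_cast hNpos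
  have hxk : x < ((⌊x⌋₊ + 1 : ℕ) : ℝ) := by exact_mod_cast Nat.lt_floor_add_one x
  have hfact : (N : ℝ) ^ (1 + s) < ((⌊x⌋₊ + 1).factorial : ℝ) := by
    rw [← Real.log_lt_log_iff (by positivity) (by positivity), Real.log_rpow hN0]
    calc (1 + s) * Real.log N < x * (Real.log x - 1) := hlt
      _ ≤ ((⌊x⌋₊ + 1 : ℕ) : ℝ) * (Real.log ((⌊x⌋₊ + 1 : ℕ) : ℝ) - 1) := by gcongr
      _ ≤ _ := Real.mul_log_sub_one_le_log_factorial _ (Nat.succ_pos _)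
  obtain ⟨T, hT, hST⟩ := Finset.exists_card_eq_forall_card_inter_lt 𝒮 N (⌊x⌋₊ + 1) hX h𝒮
    (by exact_mod_cast hcard.trans_lt hfact)
  exact ⟨T, hT, fun S hS =>
    (Nat.le_floor_iff hx.le).1 (Nat.lt_succ_iff.1 (hST S hS))⟩
end

section
/- For all integers N ≥ 1 and 0 ≤ k ≤ N, one has k! · (N choose k) · (N² − N choose N − k) ≤ (N² choose N). Equivalently, if an N-element subset S' of an N²-element set is chosen uniformly at random and S is a fixed N-element subset, then the probability that |S ∩ S'| = k is at most 1/k!. -/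
theorem Nat.sq_tsub_le_sq_tsub (n i : ℕ) : (n - i) ^ 2 ≤ n ^ 2 - i := by
  obtain h | h := Nat.le_total n i
  · simp [Nat.sub_eq_zero_of_le h]
  · obtain ⟨d, rfl⟩ := Nat.exists_eq_add_of_le h
    rw [Nat.add_sub_cancel_left]
    apply Nat.le_sub_of_add_le
    nlinarith [Nat.le_self_pow two_ne_zero i, Nat.zero_le (i * d)]

theorem Nat.sq_descFactorial_le_descFactorial_sq (n k : ℕ) :
    n.descFactorial k ^ 2 ≤ (n ^ 2).descFactorial k := by
  induction k with
  | zero => simp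
  | succ k ih =>
    rw [Nat.descFactorial_succ, Nat.descFactorial_succ, mul_pow]
    exact Nat.mul_le_mul (Nat.sq_tsub_le_sq_tsub n k) ih

theorem Nat.factorial_mul_sq_choose_le_choose_sq (n k : ℕ) :
    k.factorial * n.choose k ^ 2 ≤ (n ^ 2).choose k := by
  have h := Nat.sq_descFactorial_le_descFactorial_sq n k
  rw [Nat.descFactorial_eq_factorial_mul_choose, Nat.descFactorial_eq_factorial_mul_choose] at h
  refine Nat.le_of_mul_le_mul_left ?_ k.factorial_pos
  linarith

/-- For `1 ≤ N` and `k ≤ N`,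
`k! · C(N,k) · C(N²−N, N−k) ≤ C(N², N)`; equivalently, the probability that a
uniformly random `N`-subset `S'` of an `N²`-set meets a fixed `N`-set `S` in
exactly `k` elements is at most `1/k!`. -/
theorem stmt1 (N k : ℕ) (hN : 1 ≤ N) (hk : k ≤ N) :
    k.factorial * N.choose k * (N ^ 2 - N).choose (N - k) ≤ (N ^ 2).choose N := by
  refine Nat.le_of_mul_le_mul_right ?_ (Nat.choose_pos hk)
  rw [Nat.choose_mul hk]
  calc k.factorial * N.choose k * (N ^ 2 - N).choose (N - k) * N.choose k
      = k.factorial * N.choose k ^ 2 * (N ^ 2 - N).choose (N - k) := by ring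
    _ ≤ (N ^ 2).choose k * (N ^ 2 - k).choose (N - k) :=
      Nat.mul_le_mul (Nat.factorial_mul_sq_choose_le_choose_sq N k)
        (Nat.choose_le_choose _ (Nat.sub_le_sub_left hk _))
end

section
/- (Erdős–Spencer covering bound.) For all integers 0 < l < k < n one has M(n, k, l) ≤ ((n choose l)/(k choose l)) · (1 + log (k choose l)) + 1, where log is the natural logarithm. -/
/-- `IsCover n k l F` : `F` is a family of `k`-element subsets of `Fin n` such that every
`l`-element subset of `Fin n` is contained in some member of `F`. -/
def IsCover (n k l : ℕ) (F : Finset (Finset (Fin n))) : Prop :=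
  (∀ S ∈ F, S.card = k) ∧ ∀ L : Finset (Fin n), L.card = l → ∃ S ∈ F, L ⊆ S

/-- `coverNumber n k l` is `M(n,k,l)` : the minimum cardinality of a family of `k`-element
subsets of an `n`-element set covering all `l`-element subsets. -/
noncomputable def coverNumber (n k l : ℕ) : ℕ :=
  sInf {m | ∃ F : Finset (Finset (Fin n)), IsCover n k l F ∧ F.card = m}

open Finset

/-- Averaging: among the `k`-subsets of an `n`-set, some member contains at least the average
proportion of a given family `U` of `l`-subsets. -/
theorem exists_powersetCard_superset_count {n k l : ℕ} (hlk : l ≤ k) (hkn : k ≤ n)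
    (U : Finset (Finset (Fin n))) (hU : ∀ L ∈ U, #L = l) :
    ∃ S : Finset (Fin n), #S = k ∧
      (k.choose l : ℝ) / n.choose l * #U ≤ #{L ∈ U | L ⊆ S} := by
  have hsum : ∑ S ∈ powersetCard k (univ : Finset (Fin n)), #{L ∈ U | L ⊆ S} =
      #U * (n - l).choose (k - l) := by
    have h := sum_card_bipartiteAbove_eq_sum_card_bipartiteBelow (s := U)
      (t := powersetCard k (univ : Finset (Fin n))) (fun L S => L ⊆ S)
    simp only [bipartiteAbove, bipartiteBelow] at h
    rw [← h, ← smul_eq_mul, ← sum_const]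
    refine sum_congr rfl fun L hL => ?_
    rw [card_filter_powersetCard_subset L univ k (subset_univ L) ((hU L hL).trans_le hlk), hU L hL,
      card_fin]
  have hne : (powersetCard k (univ : Finset (Fin n))).Nonempty :=
    powersetCard_nonempty.2 (by simpa using hkn)
  have hpos : (0 : ℝ) < n.choose l := mod_cast Nat.choose_pos (hlk.trans hkn)
  have hmul : (n.choose k * k.choose l : ℝ) = n.choose l * (n - l).choose (k - l) :=
    mod_cast Nat.choose_mul hlk
  have havg : ∑ _S ∈ powersetCard k (univ : Finset (Fin n)),
      (k.choose l : ℝ) / n.choose l * #U ≤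
      ∑ S ∈ powersetCard k (univ : Finset (Fin n)), (#{L ∈ U | L ⊆ S} : ℝ) := by
    rw [← Nat.cast_sum, hsum, sum_const, card_powersetCard, card_fin, nsmul_eq_mul]
    push_cast
    refine le_of_eq ?_
    field_simp
    linear_combination (#U : ℝ) * hmul
  obtain ⟨S, hS, hle⟩ := exists_le_of_sum_le hne havg
  exact ⟨S, (mem_powersetCard.1 hS).2, hle⟩

/-- Greedy choice: `t` members can be chosen so that the proportion of uncovered `l`-subsets
decays geometrically. -/
theorem exists_greedy_partial_cover {n k l : ℕ} (hlk : l ≤ k) (hkn : k ≤ n) (t : ℕ) :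
    ∃ F : Finset (Finset (Fin n)), (∀ S ∈ F, #S = k) ∧ #F ≤ t ∧
      (#{L ∈ powersetCard l (univ : Finset (Fin n)) | ∀ S ∈ F, ¬L ⊆ S} : ℝ) ≤
        n.choose l * (1 - (k.choose l : ℝ) / n.choose l) ^ t := by
  induction t with
  | zero => exact ⟨∅, by simp⟩
  | succ t ih =>
    obtain ⟨F, hFk, hFt, hF⟩ := ih
    set U := {L ∈ powersetCard l (univ : Finset (Fin n)) | ∀ S ∈ F, ¬L ⊆ S} with hUdef
    obtain ⟨S, hSk, hS⟩ := exists_powersetCard_superset_count hlk hkn U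
      fun L hL => (mem_powersetCard.1 (mem_filter.1 hL).1).2
    refine ⟨insert S F, by simpa [hSk] using hFk,
      (card_insert_le _ _).trans (Nat.succ_le_succ hFt), ?_⟩
    have hsplit : {L ∈ powersetCard l (univ : Finset (Fin n)) | ∀ T ∈ insert S F, ¬L ⊆ T} =
        {L ∈ U | ¬L ⊆ S} := by
      ext L
      simp only [hUdef, mem_filter, forall_mem_insert]
      tauto
    have hadd : (#{L ∈ U | L ⊆ S} : ℝ) + #{L ∈ U | ¬L ⊆ S} = #U :=
      mod_cast card_filter_add_card_filter_not (s := U) (fun L => L ⊆ S)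
    have hle : (k.choose l : ℝ) / n.choose l ≤ 1 :=
      div_le_one_of_le₀ (mod_cast Nat.choose_le_choose l hkn) (by positivity)
    rw [hsplit, pow_succ]
    have := mul_le_mul_of_nonneg_right hF (sub_nonneg.2 hle)
    linarith

/-- A partial cover extends to a cover by adding one member for each uncovered `l`-subset. -/
theorem coverNumber_le_card_add_card_uncovered {n k l : ℕ} (hlk : l ≤ k) (hkn : k ≤ n)
    (F : Finset (Finset (Fin n))) (hF : ∀ S ∈ F, #S = k) :
    coverNumber n k l ≤
      #F + #{L ∈ powersetCard l (univ : Finset (Fin n)) | ∀ S ∈ F, ¬L ⊆ S} := by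
  set U := {L ∈ powersetCard l (univ : Finset (Fin n)) | ∀ S ∈ F, ¬L ⊆ S} with hUdef
  have hext (L : Finset (Fin n)) : ∃ S : Finset (Fin n), #L = l → L ⊆ S ∧ #S = k := by
    by_cases hL : #L = l
    · obtain ⟨S, hLS, hS⟩ := exists_superset_card_eq (hL.trans_le hlk) (by simpa using hkn)
      exact ⟨S, fun _ => ⟨hLS, hS⟩⟩
    · exact ⟨∅, fun h => absurd h hL⟩
  choose g hg using hext
  have hcover : IsCover n k l (F ∪ U.image g) := by
    refine ⟨fun S hS => ?_, fun L hL => ?_⟩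
    · rcases mem_union.1 hS with hS | hS
      · exact hF S hS
      · obtain ⟨L, hL, rfl⟩ := mem_image.1 hS
        exact (hg L (mem_powersetCard.1 (mem_filter.1 hL).1).2).2
    · by_cases h : ∃ S ∈ F, L ⊆ S
      · obtain ⟨S, hS, hLS⟩ := h
        exact ⟨S, mem_union_left _ hS, hLS⟩
      · push Not at h
        refine ⟨g L, mem_union_right _ (mem_image_of_mem g ?_), (hg L hL).1⟩
        exact mem_filter.2 ⟨mem_powersetCard.2 ⟨subset_univ L, hL⟩, h⟩
  calc coverNumber n k l ≤ #(F ∪ U.image g) := Nat.sInf_le ⟨F ∪ U.image g, hcover, rfl⟩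
    _ ≤ #F + #(U.image g) := card_union_le F (U.image g)
    _ ≤ #F + #U := Nat.add_le_add_left card_image_le _

/-- Erdős–Spencer covering bound:
`M(n,k,l) ≤ (C(n,l)/C(k,l))·(1 + log C(k,l)) + 1` for `0 < l < k < n`. -/
theorem stmt3 (n k l : ℕ) (hl : 0 < l) (hlk : l < k) (hkn : k < n) :
    (coverNumber n k l : ℝ) ≤
      ((n.choose l : ℝ) / (k.choose l : ℝ)) * (1 + Real.log (k.choose l)) + 1 := by
  have hK : (0 : ℝ) < k.choose l := mod_cast Nat.choose_pos hlk.le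
  have hN : (0 : ℝ) < n.choose l := mod_cast Nat.choose_pos (hlk.trans hkn).le
  have hlog : 0 ≤ Real.log (k.choose l) := Real.log_natCast_nonneg _
  set x : ℝ := (n.choose l : ℝ) / k.choose l * Real.log (k.choose l) with hx
  set r : ℝ := (k.choose l : ℝ) / n.choose l with hr
  have hr0 : 0 < r := by positivity
  have hr1 : r ≤ 1 := div_le_one_of_le₀ (mod_cast Nat.choose_le_choose l hkn.le) hN.le
  obtain ⟨F, hFk, hFt, hF⟩ := exists_greedy_partial_cover hlk.le hkn.le ⌈x⌉₊
  have hceil : (⌈x⌉₊ : ℝ) < x + 1 := Nat.ceil_lt_add_one (by positivity)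
  have hpow : (1 - r) ^ ⌈x⌉₊ ≤ (k.choose l : ℝ)⁻¹ := by
    calc (1 - r) ^ ⌈x⌉₊ ≤ Real.exp (-r) ^ ⌈x⌉₊ :=
          pow_le_pow_left₀ (sub_nonneg.2 hr1) (Real.one_sub_le_exp_neg r) _
      _ = Real.exp (-(⌈x⌉₊ * r)) := by rw [← Real.exp_nat_mul, mul_neg]
      _ ≤ Real.exp (-(x * r)) := by gcongr; exact Nat.le_ceil x
      _ = (k.choose l : ℝ)⁻¹ := by
          have hxr : x * r = Real.log (k.choose l) := by rw [hx, hr]; field_simp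
          rw [hxr, Real.exp_neg, Real.exp_log hK]
  have hcov : (coverNumber n k l : ℝ) ≤
      #F + #{L ∈ powersetCard l (univ : Finset (Fin n)) | ∀ S ∈ F, ¬L ⊆ S} :=
    mod_cast coverNumber_le_card_add_card_uncovered hlk.le hkn.le F hFk
  have hFt' : (#F : ℝ) ≤ ⌈x⌉₊ := mod_cast hFt
  have hunc := hF.trans (mul_le_mul_of_nonneg_left hpow hN.le)
  rw [← div_eq_mul_inv] at hunc
  rw [mul_add, mul_one, ← hx]
  linarith
end

section
/- For all integers 0 < l < k < n and every natural number x, one has M(n, k, l) ≤ (n choose l) · (1 − (k choose l)/(n choose l))^x + x, where the power is real exponentiation. -/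
/-- The number of `k`-element supersets of an `l`-element subset of an `n`-element set. -/
theorem card_filter_superset_powersetCard {n k l : ℕ} (hlk : l ≤ k) (L : Finset (Fin n))
    (hL : L.card = l) :
    ((Finset.powersetCard k Finset.univ).filter (fun S : Finset (Fin n) => L ⊆ S)).card =
      (n - l).choose (k - l) := by
  have hc : (Finset.powersetCard (k - l) Lᶜ).card = (n - l).choose (k - l) := by
    rw [Finset.card_powersetCard, Finset.card_compl, Fintype.card_fin, hL]
  rw [← hc]
  refine Finset.card_bij' (fun S _ => S \ L) (fun T _ => T ∪ L) ?_ ?_ ?_ ?_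
  · intro S hS
    obtain ⟨hS, hLS⟩ := Finset.mem_filter.mp hS
    have hS := (Finset.mem_powersetCard.mp hS).2
    refine Finset.mem_powersetCard.mpr ⟨fun a ha => ?_, ?_⟩
    · exact Finset.mem_compl.mpr (Finset.mem_sdiff.mp ha).2
    · rw [Finset.card_sdiff_of_subset hLS, hS, hL]
  · intro T hT
    obtain ⟨hT, hTk⟩ := Finset.mem_powersetCard.mp hT
    have hd : Disjoint T L := Finset.subset_compl_iff_disjoint_right.mp hT
    refine Finset.mem_filter.mpr
      ⟨Finset.mem_powersetCard.mpr ⟨Finset.subset_univ _, ?_⟩, Finset.subset_union_right⟩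
    rw [Finset.card_union_of_disjoint hd, hTk, hL]
    omega
  · intro S hS
    exact Finset.sdiff_union_of_subset (Finset.mem_filter.mp hS).2
  · intro T hT
    have hd : Disjoint T L :=
      Finset.subset_compl_iff_disjoint_right.mp (Finset.mem_powersetCard.mp hT).1
    exact Finset.union_sdiff_cancel_right hd

/-- Some `k`-set contains at least the average proportion of the members of a family of
`l`-sets. -/
theorem exists_card_eq_mul_choose_le {n k l : ℕ} (hlk : l ≤ k) (hkn : k ≤ n)
    (U : Finset (Finset (Fin n))) (hU : ∀ L ∈ U, L.card = l) :
    ∃ S : Finset (Fin n), S.card = k ∧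
      U.card * k.choose l ≤ (U.filter (fun L => L ⊆ S)).card * n.choose l := by
  by_contra! h
  have hsum : ∑ S ∈ Finset.powersetCard k (Finset.univ : Finset (Fin n)),
      (U.filter (fun L => L ⊆ S)).card = U.card * (n - l).choose (k - l) := by
    refine (Finset.sum_card_bipartiteAbove_eq_sum_card_bipartiteBelow
      (fun L S : Finset (Fin n) => L ⊆ S)).symm.trans ?_
    exact Finset.sum_const_nat fun L hL => card_filter_superset_powersetCard hlk L (hU L hL)
  have hcard : (Finset.powersetCard k (Finset.univ : Finset (Fin n))).card = n.choose k := by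
    simp
  have hne : (Finset.powersetCard k (Finset.univ : Finset (Fin n))).Nonempty := by
    rw [← Finset.card_pos, hcard]
    exact Nat.choose_pos hkn
  have hlt := Finset.sum_lt_sum_of_nonempty hne
    fun S hS => h S (Finset.mem_powersetCard.mp hS).2
  rw [← Finset.sum_mul, hsum, Finset.sum_const, hcard, smul_eq_mul] at hlt
  have hmul := Nat.choose_mul (n := n) hlk
  have : U.card * (n - l).choose (k - l) * n.choose l = n.choose k * (U.card * k.choose l) := by
    rw [mul_left_comm, hmul]
    ring
  omega

/-- The `l`-subsets of `Fin n` contained in no member of `F`. -/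
def uncovered (n l : ℕ) (F : Finset (Finset (Fin n))) : Finset (Finset (Fin n)) :=
  (Finset.powersetCard l Finset.univ).filter fun L => ∀ S ∈ F, ¬ L ⊆ S

theorem mem_uncovered {n l : ℕ} {F : Finset (Finset (Fin n))} {L : Finset (Fin n)} :
    L ∈ uncovered n l F ↔ L.card = l ∧ ∀ S ∈ F, ¬ L ⊆ S := by
  simp [uncovered]

/-- Greedy choice of `x` sets of size `k`. -/
theorem exists_card_uncovered_le {n k l : ℕ} (hlk : l ≤ k) (hkn : k ≤ n) (x : ℕ) :
    ∃ F : Finset (Finset (Fin n)), (∀ S ∈ F, S.card = k) ∧ F.card ≤ x ∧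
      ((uncovered n l F).card : ℝ) ≤
        (n.choose l : ℝ) * (1 - (k.choose l : ℝ) / (n.choose l : ℝ)) ^ x := by
  induction x with
  | zero => exact ⟨∅, by simp, by simp, by simp [uncovered]⟩
  | succ x ih =>
    obtain ⟨F, hF, hFx, hU⟩ := ih
    obtain ⟨S, hS, hle⟩ := exists_card_eq_mul_choose_le hlk hkn (uncovered n l F)
      fun L hL => (mem_uncovered.mp hL).1
    refine ⟨insert S F, ?_, (Finset.card_insert_le S F).trans (by omega), ?_⟩
    · simpa [hS] using hF
    have hn : (0 : ℝ) < n.choose l := by exact_mod_cast Nat.choose_pos (hlk.trans hkn)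
    have hkn' : (k.choose l : ℝ) ≤ n.choose l := by
      exact_mod_cast Nat.choose_le_choose l hkn
    have hp : (0 : ℝ) ≤ 1 - (k.choose l : ℝ) / n.choose l :=
      sub_nonneg.mpr ((div_le_one hn).mpr hkn')
    have hins : uncovered n l (insert S F) = (uncovered n l F).filter fun L => ¬ L ⊆ S := by
      ext L
      simp only [mem_uncovered, Finset.mem_filter, Finset.forall_mem_insert]
      tauto
    have hsplit := Finset.card_filter_add_card_filter_not (s := uncovered n l F)
      (fun L : Finset (Fin n) => L ⊆ S)
    rw [← hins] at hsplit
    have hsplit' : (((uncovered n l F).filter fun L => L ⊆ S).card : ℝ) +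
        (uncovered n l (insert S F)).card = (uncovered n l F).card := by exact_mod_cast hsplit
    have hle' : ((uncovered n l F).card : ℝ) * (k.choose l / n.choose l) ≤
        ((uncovered n l F).filter fun L => L ⊆ S).card := by
      rw [← mul_div_assoc, div_le_iff₀ hn]
      exact_mod_cast hle
    calc ((uncovered n l (insert S F)).card : ℝ)
        ≤ (uncovered n l F).card * (1 - (k.choose l : ℝ) / n.choose l) := by linarith
      _ ≤ (n.choose l * (1 - (k.choose l : ℝ) / n.choose l) ^ x) *
            (1 - (k.choose l : ℝ) / n.choose l) := mul_le_mul_of_nonneg_right hU hp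
      _ = n.choose l * (1 - (k.choose l : ℝ) / n.choose l) ^ (x + 1) := by ring

/-- Any family of `k`-sets extends to a cover with one further set per uncovered `l`-set. -/
theorem coverNumber_le_card_uncovered_add {n k l : ℕ} (hlk : l ≤ k) (hkn : k ≤ n)
    (F : Finset (Finset (Fin n))) (hF : ∀ S ∈ F, S.card = k) :
    coverNumber n k l ≤ (uncovered n l F).card + F.card := by
  have hext : ∀ L : Finset (Fin n), ∃ S : Finset (Fin n), L.card = l → L ⊆ S ∧ S.card = k := by
    intro L
    by_cases hL : L.card = l
    · obtain ⟨S, hLS, hS⟩ := Finset.exists_superset_card_eq (s := L) (n := k)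
        (by omega) (by simpa using hkn)
      exact ⟨S, fun _ => ⟨hLS, hS⟩⟩
    · exact ⟨∅, fun h => absurd h hL⟩
  choose g hg using hext
  have hcover : IsCover n k l ((uncovered n l F).image g ∪ F) := by
    refine ⟨fun S hS => ?_, fun L hL => ?_⟩
    · rcases Finset.mem_union.mp hS with hS | hS
      · obtain ⟨L, hL, rfl⟩ := Finset.mem_image.mp hS
        exact (hg L (mem_uncovered.mp hL).1).2
      · exact hF S hS
    · by_cases h : ∃ S ∈ F, L ⊆ S
      · obtain ⟨S, hS, hLS⟩ := h
        exact ⟨S, Finset.mem_union_right _ hS, hLS⟩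
      · push Not at h
        exact ⟨g L, Finset.mem_union_left _
          (Finset.mem_image_of_mem g (mem_uncovered.mpr ⟨hL, h⟩)), (hg L hL).1⟩
  calc coverNumber n k l ≤ ((uncovered n l F).image g ∪ F).card := Nat.sInf_le ⟨_, hcover, rfl⟩
    _ ≤ ((uncovered n l F).image g).card + F.card := Finset.card_union_le _ _
    _ ≤ (uncovered n l F).card + F.card := Nat.add_le_add_right Finset.card_image_le _

/-- For all integers `0 < l < k < n` and every natural number `x`,
`M(n,k,l) ≤ C(n,l)·(1 − C(k,l)/C(n,l))^x + x` (real exponentiation). -/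
theorem stmt4 (n k l : ℕ) (hl : 0 < l) (hlk : l < k) (hkn : k < n) (x : ℕ) :
    (coverNumber n k l : ℝ) ≤
      (n.choose l : ℝ) * (1 - (k.choose l : ℝ) / (n.choose l : ℝ)) ^ (x : ℝ) + x := by
  obtain ⟨F, hF, hFx, hU⟩ := exists_card_uncovered_le hlk.le hkn.le x
  have hcover : (coverNumber n k l : ℝ) ≤ (uncovered n l F).card + F.card := by
    exact_mod_cast coverNumber_le_card_uncovered_add hlk.le hkn.le F hF
  have hFx' : (F.card : ℝ) ≤ x := by exact_mod_cast hFx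
  rw [Real.rpow_natCast]
  linarith
end

section
/- There exists an absolute constant C > 0 such that for all integers m ≥ 2 and N with m ∣ N and m³ ≤ N, there is a family 𝒮 of N-element subsets of a set X of size N² with the following properties: (i) m^{m−1}·N ≤ |𝒮| ≤ C·m^m·N·log N; (ii) for every N-element subset S' ⊆ X there exists S ∈ 𝒮 with |S ∩ S'| ≥ m; (iii) every element of X belongs to at least m^{m−1} members of 𝒮. -/
open Finset

/-- If every element of a finite set `A` is related to at least a proportion `p` of a finite
set `B`, then `t` greedily chosen elements of `B` leave at most `(1 - p) ^ t * #A` elements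
of `A` unrelated to all of them. -/
theorem exists_greedy_cover {α β : Type*} [DecidableEq β] (r : α → β → Prop)
    [∀ a b, Decidable (r a b)] (A : Finset α) (B : Finset β) (hB : B.Nonempty) (p : ℝ)
    (hp : p ≤ 1) (h : ∀ a ∈ A, p * #B ≤ #{b ∈ B | r a b}) (t : ℕ) :
    ∃ D ⊆ B, #D ≤ t ∧ (#{a ∈ A | ∀ b ∈ D, ¬ r a b} : ℝ) ≤ (1 - p) ^ t * #A := by
  induction t with
  | zero => exact ⟨∅, by simp, by simp, by simp⟩
  | succ t ih =>
    obtain ⟨D, hDB, hDt, hD⟩ := ih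
    set R := {a ∈ A | ∀ b ∈ D, ¬ r a b} with hR
    have double : ∑ b ∈ B, (#{a ∈ R | r a b} : ℝ) = ∑ a ∈ R, (#{b ∈ B | r a b} : ℝ) := by
      exact_mod_cast (sum_card_bipartiteAbove_eq_sum_card_bipartiteBelow (s := R) (t := B) r).symm
    have lower : ∑ b ∈ B, p * (#R : ℝ) ≤ ∑ b ∈ B, (#{a ∈ R | r a b} : ℝ) := by
      rw [double]
      calc ∑ b ∈ B, p * (#R : ℝ) = ∑ a ∈ R, p * (#B : ℝ) := by
            simp only [sum_const, nsmul_eq_mul]; ring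
        _ ≤ _ := sum_le_sum fun a ha => h a (mem_filter.1 ha).1
    obtain ⟨b, hb, hpb⟩ := exists_le_of_sum_le hB lower
    refine ⟨insert b D, insert_subset hb hDB, (card_insert_le _ _).trans (by omega), ?_⟩
    have split : #{a ∈ R | r a b} + #{a ∈ R | ¬ r a b} = #R :=
      card_filter_add_card_filter_not _
    have left : {a ∈ A | ∀ b' ∈ insert b D, ¬ r a b'} = {a ∈ R | ¬ r a b} := by
      ext a
      simp only [hR, mem_filter, mem_insert, forall_eq_or_imp]
      tauto
    rw [left]
    have split' : (#{a ∈ R | r a b} : ℝ) + #{a ∈ R | ¬ r a b} = #R := by exact_mod_cast split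
    calc (#{a ∈ R | ¬ r a b} : ℝ) ≤ (1 - p) * #R := by linarith
      _ ≤ (1 - p) * ((1 - p) ^ t * #A) := mul_le_mul_of_nonneg_left hD (by linarith)
      _ = _ := by ring

/-- A covering version of the greedy lemma: about `log #A / p` elements of `B` suffice. -/
theorem exists_small_cover {α β : Type*} [DecidableEq β] (r : α → β → Prop)
    [∀ a b, Decidable (r a b)] (A : Finset α) (B : Finset β) (hB : B.Nonempty) (p : ℝ)
    (hp₀ : 0 < p) (hp : p ≤ 1) (h : ∀ a ∈ A, p * #B ≤ #{b ∈ B | r a b}) (hA : A.Nonempty) :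
    ∃ D ⊆ B, (#D : ℝ) ≤ Real.log #A / p + 2 ∧ ∀ a ∈ A, ∃ b ∈ D, r a b := by
  have hA' : (1 : ℝ) ≤ #A := by exact_mod_cast hA.card_pos
  have hlog : 0 ≤ Real.log #A / p := div_nonneg (Real.log_nonneg hA') hp₀.le
  obtain ⟨D, hDB, hDt, hD⟩ :=
    exists_greedy_cover r A B hB p hp h (⌊Real.log #A / p⌋₊ + 1)
  refine ⟨D, hDB, ?_, ?_⟩
  · have h₁ : (#D : ℝ) ≤ ⌊Real.log #A / p⌋₊ + 1 := by exact_mod_cast hDt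
    linarith [Nat.floor_le hlog]
  · have hlt : Real.log #A < p * ((⌊Real.log #A / p⌋₊ + 1 : ℕ) : ℝ) := by
      have := Nat.lt_floor_add_one (Real.log #A / p)
      rw [div_lt_iff₀ hp₀] at this
      push_cast
      linarith
    have hpow : (1 - p) ^ (⌊Real.log #A / p⌋₊ + 1) * (#A : ℝ) < 1 := by
      generalize ⌊Real.log #A / p⌋₊ + 1 = t at hlt
      calc (1 - p) ^ t * (#A : ℝ) ≤ Real.exp (-p) ^ t * #A := by
            have := pow_le_pow_left₀ (by linarith) (Real.one_sub_le_exp_neg p) t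
            gcongr
        _ = Real.exp (-(p * t)) * Real.exp (Real.log #A) := by
            rw [← Real.exp_nat_mul, Real.exp_log (by linarith)]
            congr 2
            ring
        _ = Real.exp (-(p * t) + Real.log #A) := (Real.exp_add _ _).symm
        _ < 1 := Real.exp_lt_one_iff.2 (by linarith)
    have hzero : #{a ∈ A | ∀ b ∈ D, ¬ r a b} = 0 := by
      have : (#{a ∈ A | ∀ b ∈ D, ¬ r a b} : ℝ) < 1 := hD.trans_lt hpow
      exact Nat.lt_one_iff.1 (by exact_mod_cast this)
    intro a ha
    by_contra! hcon
    rw [card_eq_zero] at hzero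
    exact notMem_empty a (hzero ▸ mem_filter.2 ⟨ha, hcon⟩)

/-- A lower bound for the number of `N`-sets meeting a given set in at least `m` elements. -/
theorem choose_mul_choose_le_card_inter {X : Type*} [Fintype X] [DecidableEq X]
    (S' : Finset X) {m N : ℕ} (hmN : m ≤ N) :
    (#S').choose m * (Fintype.card X - #S').choose (N - m) ≤
      #{S ∈ powersetCard N (univ : Finset X) | m ≤ #(S ∩ S')} := by
  rw [← card_compl, ← card_powersetCard, ← card_powersetCard, ← card_product]
  have parts : ∀ q ∈ powersetCard m S' ×ˢ powersetCard (N - m) S'ᶜ,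
      (q.1 ∪ q.2) ∩ S' = q.1 ∧ (q.1 ∪ q.2) \ S' = q.2 := by
    rintro ⟨P, Q⟩ hq
    simp only [mem_product, mem_powersetCard] at hq
    obtain ⟨⟨hP, -⟩, hQ, -⟩ := hq
    constructor
    · ext x
      have h₁ := @hP x
      have h₂ := @hQ x
      simp only [mem_compl] at h₂
      simp only [mem_inter, mem_union]
      tauto
    · ext x
      have h₁ := @hP x
      have h₂ := @hQ x
      simp only [mem_compl] at h₂
      simp only [mem_sdiff, mem_union]
      tauto
  refine card_le_card_of_injOn (fun q => q.1 ∪ q.2) ?_ ?_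
  · rintro q hq
    have hq' := mem_coe.1 hq
    have hparts := parts q hq'
    simp only [mem_product, mem_powersetCard] at hq'
    obtain ⟨⟨hP, hPm⟩, hQ, hQm⟩ := hq'
    have hdisj : Disjoint q.1 q.2 :=
      disjoint_of_subset_left hP (disjoint_of_subset_right hQ disjoint_compl_right)
    simp only [coe_filter, mem_powersetCard, subset_univ, true_and, Set.mem_ofPred_eq]
    rw [hparts.1, card_union_of_disjoint hdisj]
    omega
  · intro q hq q' hq' heq
    have h₁ := parts q (mem_coe.1 hq)
    have h₂ := parts q' (mem_coe.1 hq')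
    simp only at heq
    rw [heq] at h₁
    exact Prod.ext (h₁.1.symm.trans h₂.1) (h₁.2.symm.trans h₂.2)

theorem choose_add_mul_pow_le_choose (n k j : ℕ) (hk : k ≤ n) :
    ((n + j).choose k : ℝ) * (1 - k / (n + 1)) ^ j ≤ n.choose k := by
  have hn : (0 : ℝ) < n + 1 := by positivity
  have hkn : (k : ℝ) ≤ n := by exact_mod_cast hk
  have hbase : (0 : ℝ) ≤ 1 - k / (n + 1) := by
    rw [sub_nonneg, div_le_one hn]
    linarith
  induction j with
  | zero => simp
  | succ j ih =>
    have step : ((n + j + 1).choose k : ℝ) * (1 - k / (n + 1)) ≤ (n + j).choose k := by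
      have key : ((n + j).choose k : ℝ) * (n + j + 1) =
          (n + j + 1).choose k * (n + j + 1 - k) := by
        have := Nat.choose_mul_succ_eq (n + j) k
        have hsub : ((n + j + 1 - k : ℕ) : ℝ) = n + j + 1 - k := by
          rw [Nat.cast_sub (by omega)]
          push_cast
          ring
        rw [← hsub]
        exact_mod_cast this
      have hnj : (0 : ℝ) < n + j + 1 := by positivity
      have hfrac : 1 - (k : ℝ) / (n + 1) ≤ 1 - k / (n + j + 1) := by
        gcongr
        linarith [(Nat.cast_nonneg j : (0 : ℝ) ≤ j)]
      calc ((n + j + 1).choose k : ℝ) * (1 - k / (n + 1))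
          ≤ (n + j + 1).choose k * (1 - k / (n + j + 1)) := by gcongr
        _ = (n + j).choose k := by
            field_simp
            linarith
    calc ((n + (j + 1)).choose k : ℝ) * (1 - k / (n + 1)) ^ (j + 1)
        = ((n + j + 1).choose k * (1 - k / (n + 1))) * (1 - k / (n + 1)) ^ j := by
          rw [← add_assoc]; ring
      _ ≤ (n + j).choose k * (1 - k / (n + 1)) ^ j := by gcongr
      _ ≤ _ := ih

theorem exp_neg_one_le_one_sub_inv_pow {N j : ℕ} (hN : 2 ≤ N) (hj : j ≤ N - 1) :
    Real.exp (-1) ≤ (1 - 1 / (N : ℝ)) ^ j := by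
  obtain ⟨n, rfl⟩ : ∃ n, N = n + 1 := ⟨N - 1, by omega⟩
  have hn : (0 : ℝ) < n := by exact_mod_cast (by omega : 0 < n)
  have hjn : (j : ℝ) ≤ n := by exact_mod_cast hj
  have hbase : (1 - 1 / ((n + 1 : ℕ) : ℝ)) = (1 + 1 / (n : ℝ))⁻¹ := by
    push_cast
    field_simp
    ring
  rw [hbase, inv_pow, Real.exp_neg]
  apply inv_anti₀ (by positivity)
  calc (1 + 1 / (n : ℝ)) ^ j ≤ Real.exp (1 / n) ^ j := by
        gcongr
        linarith [Real.add_one_le_exp (1 / (n : ℝ))]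
    _ = Real.exp (j * (1 / n)) := (Real.exp_nat_mul _ _).symm
    _ ≤ Real.exp 1 := by
        gcongr
        rw [mul_one_div, div_le_one hn]
        exact hjn

theorem choose_sq_sub_le {m N : ℕ} (hm : 1 ≤ m) (hN : 2 ≤ N) (hmN : m ≤ N) :
    ((N ^ 2 - m).choose (N - m) : ℝ) ≤ 3 * (N ^ 2 - N).choose (N - m) := by
  have hsq : 2 * N ≤ N ^ 2 := by nlinarith
  have hNR : (2 : ℝ) ≤ N := by exact_mod_cast hN
  have hmR : (1 : ℝ) ≤ m := by exact_mod_cast hm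
  have hmNR : (m : ℝ) ≤ N := by exact_mod_cast hmN
  have key := choose_add_mul_pow_le_choose (N ^ 2 - N) (N - m) (N - m) (by omega)
  rw [show N ^ 2 - N + (N - m) = N ^ 2 - m by omega] at key
  have hfrac : ((N - m : ℕ) : ℝ) / ((N ^ 2 - N : ℕ) + 1) ≤ 1 / N := by
    rw [Nat.cast_sub hmN, Nat.cast_sub (by omega)]
    push_cast
    rw [div_le_div_iff₀ (by nlinarith) (by linarith)]
    nlinarith
  have hpow : Real.exp (-1) ≤ (1 - ((N - m : ℕ) : ℝ) / ((N ^ 2 - N : ℕ) + 1)) ^ (N - m) := by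
    refine (exp_neg_one_le_one_sub_inv_pow hN (by omega : N - m ≤ N - 1)).trans ?_
    gcongr
    rw [sub_nonneg, div_le_one (by linarith)]
    linarith
  have hexp : (1 : ℝ) / 3 ≤ Real.exp (-1) := by
    rw [Real.exp_neg, one_div]
    exact inv_anti₀ (by positivity) (by linarith [Real.exp_one_lt_d9])
  have hchain := mul_le_mul_of_nonneg_left (hexp.trans hpow)
    (Nat.cast_nonneg ((N ^ 2 - m).choose (N - m)) : (0 : ℝ) ≤ _)
  linarith

theorem choose_sq_le_factorial_mul {m N : ℕ} (hm : 2 ≤ m) (hN : m ^ 3 ≤ N) :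
    ((N ^ 2).choose m : ℝ) ≤ 2 * m.factorial * (N.choose m : ℝ) ^ 2 := by
  have hmN : m ≤ N := (Nat.le_self_pow (by norm_num) m).trans hN
  have hmR : (2 : ℝ) ≤ m := by exact_mod_cast hm
  have hmNR : (m : ℝ) ≤ N := by exact_mod_cast hmN
  have hNR : (m : ℝ) ^ 3 ≤ N := by exact_mod_cast hN
  have hNpos : (0 : ℝ) < N := by linarith
  have hfac : (0 : ℝ) < m.factorial := by exact_mod_cast m.factorial_pos
  have upper : ((N ^ 2).choose m : ℝ) ≤ ((N : ℝ) ^ 2) ^ m / m.factorial := by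
    exact_mod_cast Nat.choose_le_pow_div (α := ℝ) m (N ^ 2)
  have lower : ((N + 1 - m : ℕ) : ℝ) ^ m / m.factorial ≤ N.choose m := by
    simpa using Nat.pow_le_choose (α := ℝ) m N
  have hsub : ((N + 1 - m : ℕ) : ℝ) = N * (1 + -((m - 1) / N)) := by
    rw [Nat.cast_sub (by omega)]
    push_cast
    field_simp
    ring
  have bernoulli : (1 : ℝ) / 2 ≤ (1 + -(((m : ℝ) - 1) / N)) ^ (2 * m) := by
    have hle : ((m : ℝ) - 1) / N ≤ 1 := by
      rw [div_le_one hNpos]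
      linarith
    refine le_trans ?_ (one_add_mul_le_pow (by linarith) (2 * m))
    have : 2 * (m : ℝ) * ((m - 1) / N) ≤ 1 / 2 := by
      rw [← mul_div_assoc, div_le_iff₀ hNpos]
      nlinarith [mul_nonneg (by linarith : (0 : ℝ) ≤ m) (sq_nonneg ((m : ℝ) - 2))]
    push_cast
    linarith
  have square : ((N : ℝ) ^ 2) ^ m ≤ 2 * (((N + 1 - m : ℕ) : ℝ) ^ m) ^ 2 := by
    rw [hsub, ← pow_mul, ← pow_mul, mul_comm m 2, mul_pow]
    have : (0 : ℝ) < (N : ℝ) ^ (2 * m) := by positivity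
    nlinarith
  calc ((N ^ 2).choose m : ℝ) ≤ ((N : ℝ) ^ 2) ^ m / m.factorial := upper
    _ ≤ 2 * (((N + 1 - m : ℕ) : ℝ) ^ m) ^ 2 / m.factorial := by gcongr
    _ = 2 * m.factorial * (((N + 1 - m : ℕ) : ℝ) ^ m / m.factorial) ^ 2 := by
        field_simp
    _ ≤ _ := by gcongr

theorem choose_sq_le_mul_choose_mul_choose {m N : ℕ} (hm : 2 ≤ m) (hN : m ^ 3 ≤ N) :
    ((N ^ 2).choose N : ℝ) ≤
      6 * (m : ℝ) ^ m * (N.choose m * (N ^ 2 - N).choose (N - m)) := by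
  have hmN : m ≤ N := (Nat.le_self_pow (by norm_num) m).trans hN
  have hNsq : N ≤ N ^ 2 := Nat.le_self_pow (by norm_num) N
  have hpos : (0 : ℝ) < N.choose m := by exact_mod_cast Nat.choose_pos hmN
  have hfac : (m.factorial : ℝ) ≤ (m : ℝ) ^ m := by exact_mod_cast m.factorial_le_pow
  have hmul : ((N ^ 2).choose N : ℝ) * N.choose m =
      (N ^ 2).choose m * (N ^ 2 - m).choose (N - m) := by
    exact_mod_cast Nat.choose_mul (n := N ^ 2) hmN
  refine le_of_mul_le_mul_right ?_ hpos
  rw [hmul]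
  calc ((N ^ 2).choose m : ℝ) * (N ^ 2 - m).choose (N - m)
      ≤ (2 * (m : ℝ) ^ m * (N.choose m : ℝ) ^ 2) * (3 * (N ^ 2 - N).choose (N - m)) := by
        refine mul_le_mul ((choose_sq_le_factorial_mul hm hN).trans (by gcongr))
          (choose_sq_sub_le (by omega) (by omega) hmN) (by positivity) (by positivity)
    _ = _ := by ring

/-- Translates of graphs of functions: `k` parallel classes partitioning an `N ^ 2`-element set
into `N`-element sets. -/
theorem exists_uniform_family {n k : ℕ} (hk : k ≤ (n + 1) ^ n) :
    ∃ 𝒯 : Finset (Finset (Fin ((n + 1) ^ 2))),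
      (∀ S ∈ 𝒯, #S = n + 1) ∧ #𝒯 = k * (n + 1) ∧ ∀ x, k ≤ #{S ∈ 𝒯 | x ∈ S} := by
  let e : Fin (n + 1) × Fin (n + 1) ≃ Fin ((n + 1) ^ 2) :=
    Fintype.equivOfCardEq (by simp [sq])
  obtain ⟨G, -, hG⟩ := exists_subset_card_eq (s := (univ : Finset (Fin n → Fin (n + 1))))
    (n := k) (by simpa using hk)
  let φ : (Fin n → Fin (n + 1)) → Fin (n + 1) → Fin (n + 1) := fun g => Fin.cons 0 g
  let T : (Fin n → Fin (n + 1)) × Fin (n + 1) → Finset (Fin ((n + 1) ^ 2)) :=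
    fun q => univ.image fun i => e (i, φ q.1 i + q.2)
  have mem_T : ∀ q i j, e (i, j) ∈ T q ↔ j = φ q.1 i + q.2 := by
    intro q i j
    simp only [T, mem_image, mem_univ, true_and, EmbeddingLike.apply_eq_iff_eq, Prod.mk.injEq]
    constructor
    · rintro ⟨i', rfl, rfl⟩
      rfl
    · rintro rfl
      exact ⟨i, rfl, rfl⟩
  have T_inj : Function.Injective T := by
    rintro ⟨g, c⟩ ⟨g', c'⟩ h
    have hfun : ∀ i, φ g i + c = φ g' i + c' := fun i =>
      (mem_T (g', c') i _).1 (h ▸ (mem_T (g, c) i _).2 rfl)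
    have hc : c = c' := by simpa [φ] using hfun 0
    subst hc
    refine Prod.ext (funext fun i => ?_) rfl
    simpa [φ] using hfun i.succ
  refine ⟨(G ×ˢ univ).image T, ?_, ?_, ?_⟩
  · intro S hS
    obtain ⟨q, -, rfl⟩ := mem_image.1 hS
    rw [card_image_of_injective, card_univ, Fintype.card_fin]
    intro i i' h
    exact congrArg Prod.fst (e.injective h)
  · rw [card_image_of_injective _ T_inj, card_product, hG, card_univ, Fintype.card_fin]
  · intro x
    obtain ⟨⟨i, j⟩, rfl⟩ := e.surjective x
    rw [← hG]
    refine card_le_card_of_injOn (fun g => T (g, j - φ g i)) ?_ ?_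
    · intro g hg
      simp only [coe_filter, Set.mem_ofPred_eq]
      exact ⟨mem_image_of_mem _ (mem_product.2 ⟨mem_coe.1 hg, mem_univ _⟩),
        (mem_T _ _ _).2 (by simp)⟩
    · intro g _ g' _ h
      exact congrArg Prod.fst (T_inj h)

/-- Few `N`-sets suffice to meet every `N`-set in at least `m` elements. -/
theorem exists_intersecting_family {m N : ℕ} (hm : 2 ≤ m) (hN : m ^ 3 ≤ N) :
    ∃ 𝒟 : Finset (Finset (Fin (N ^ 2))), (∀ S ∈ 𝒟, #S = N) ∧
      (#𝒟 : ℝ) ≤ 12 * (m : ℝ) ^ m * N * Real.log N + 2 ∧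
      ∀ S' : Finset (Fin (N ^ 2)), #S' = N → ∃ S ∈ 𝒟, m ≤ #(S ∩ S') := by
  have hmN : m ≤ N := (Nat.le_self_pow (by norm_num) m).trans hN
  have hNsq : N ≤ N ^ 2 := Nat.le_self_pow (by norm_num) N
  have hmpow : (1 : ℝ) ≤ (m : ℝ) ^ m := one_le_pow₀ (by exact_mod_cast (by omega : 1 ≤ m))
  set B := powersetCard N (univ : Finset (Fin (N ^ 2))) with hBdef
  have hBcard : #B = (N ^ 2).choose N := by simp [hBdef]
  have hBne : B.Nonempty := by
    rw [← card_pos, hBcard]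
    exact Nat.choose_pos hNsq
  obtain ⟨D, hDB, hDcard, hD⟩ := exists_small_cover
    (fun S' S : Finset (Fin (N ^ 2)) => m ≤ #(S ∩ S')) B B hBne (1 / (6 * (m : ℝ) ^ m))
    (by positivity) (by rw [div_le_one (by positivity)]; linarith)
    (by
      intro S' hS'
      have hcard : #S' = N := (mem_powersetCard.1 hS').2
      have hcount := choose_mul_choose_le_card_inter S' hmN
      rw [hcard, Fintype.card_fin] at hcount
      have hcount' : (N.choose m : ℝ) * (N ^ 2 - N).choose (N - m) ≤
          #{S ∈ B | m ≤ #(S ∩ S')} := by exact_mod_cast hcount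
      rw [one_div, inv_mul_le_iff₀ (by positivity), hBcard]
      exact (choose_sq_le_mul_choose_mul_choose hm hN).trans (by gcongr))
    hBne
  refine ⟨D, fun S hS => (mem_powersetCard.1 (hDB hS)).2, hDcard.trans ?_, fun S' hS' =>
    hD S' (mem_powersetCard.2 ⟨subset_univ _, hS'⟩)⟩
  have hlog : Real.log #B ≤ 2 * (N * Real.log N) := by
    have hle : (#B : ℝ) ≤ ((N : ℝ) ^ 2) ^ N := by
      rw [hBcard]
      exact_mod_cast Nat.choose_le_pow (N ^ 2) N
    refine (Real.log_le_log (by exact_mod_cast hBne.card_pos) hle).trans_eq ?_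
    rw [Real.log_pow, Real.log_pow]
    push_cast
    ring
  rw [div_div_eq_mul_div, div_one]
  nlinarith


/-- There is an absolute constant `C > 0` such that for all integers `m ≥ 2`
and `N` with `m ∣ N` and `m³ ≤ N`, there is a family `𝒮` of `N`-element subsets of a set
of size `N²` with (i) `m^(m−1)·N ≤ |𝒮| ≤ C·m^m·N·log N`, (ii) every `N`-element subset
`S'` meets some `S ∈ 𝒮` in at least `m` elements, and (iii) every element of the ground
set lies in at least `m^(m−1)` members of `𝒮`. -/
theorem stmt6 :
    ∃ C : ℝ, 0 < C ∧
      ∀ m N : ℕ, 2 ≤ m → m ∣ N → m ^ 3 ≤ N →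
        ∃ 𝒮 : Finset (Finset (Fin (N ^ 2))),
          (∀ S ∈ 𝒮, S.card = N) ∧
          m ^ (m - 1) * N ≤ 𝒮.card ∧
          (𝒮.card : ℝ) ≤ C * (m : ℝ) ^ m * N * Real.log N ∧
          (∀ S' : Finset (Fin (N ^ 2)), S'.card = N → ∃ S ∈ 𝒮, m ≤ (S ∩ S').card) ∧
          (∀ x : Fin (N ^ 2), m ^ (m - 1) ≤ (𝒮.filter (fun S => x ∈ S)).card) := by
  refine ⟨15, by norm_num, fun m N hm _ hN => ?_⟩
  have hmN : m ≤ N := (Nat.le_self_pow (by norm_num) m).trans hN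
  have hN8 : 8 ≤ N := le_trans (by simpa using Nat.pow_le_pow_left hm 3) hN
  obtain ⟨𝒟, h𝒟, h𝒟card, h𝒟inter⟩ := exists_intersecting_family hm hN
  obtain ⟨𝒯, h𝒯, h𝒯card, h𝒯mem⟩ : ∃ 𝒯 : Finset (Finset (Fin (N ^ 2))),
      (∀ S ∈ 𝒯, #S = N) ∧ #𝒯 = m ^ (m - 1) * N ∧
        ∀ x, m ^ (m - 1) ≤ #{S ∈ 𝒯 | x ∈ S} := by
    obtain ⟨n, rfl⟩ : ∃ n, N = n + 1 := ⟨N - 1, by omega⟩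
    exact exists_uniform_family ((Nat.pow_le_pow_left hmN _).trans
      (Nat.pow_le_pow_right (by omega) (by omega)))
  refine ⟨𝒯 ∪ 𝒟, ?_, ?_, ?_, ?_, ?_⟩
  · intro S hS
    exact (mem_union.1 hS).elim (h𝒯 S) (h𝒟 S)
  · exact h𝒯card ▸ card_le_card subset_union_left
  · have hunion : (#(𝒯 ∪ 𝒟) : ℝ) ≤ #𝒯 + #𝒟 := by exact_mod_cast card_union_le 𝒯 𝒟
    have hT : (#𝒯 : ℝ) ≤ (m : ℝ) ^ m * N := by
      rw [h𝒯card]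
      exact_mod_cast Nat.mul_le_mul_right N (Nat.pow_le_pow_right (by omega) (Nat.sub_le m 1))
    have hNR : (8 : ℝ) ≤ N := by exact_mod_cast hN8
    have hlog : 1 ≤ Real.log N := by
      rw [Real.le_log_iff_exp_le (by linarith)]
      linarith [Real.exp_one_lt_d9]
    have hmpow : (1 : ℝ) ≤ (m : ℝ) ^ m := one_le_pow₀ (by exact_mod_cast (by omega : 1 ≤ m))
    have hprod : (8 : ℝ) ≤ (m : ℝ) ^ m * N := by nlinarith
    have hmain : (m : ℝ) ^ m * N ≤ (m : ℝ) ^ m * N * Real.log N :=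
      le_mul_of_one_le_right (by linarith) hlog
    linarith
  · intro S' hS'
    obtain ⟨S, hS, hle⟩ := h𝒟inter S' hS'
    exact ⟨S, mem_union_right _ hS, hle⟩
  · intro x
    exact (h𝒯mem x).trans (card_le_card (filter_subset_filter _ subset_union_left))
end

section
/- For every s > 0 there exists N₀ such that for every integer N ≥ N₀ there exist a set X with |X| = N² and a family 𝒮 of N-element subsets of X with |𝒮| ≤ N^{1+s}, such that for every N-element subset S' ⊆ X there is some S ∈ 𝒮 with |S ∩ S'| ≥ s·(log N)/(log log N). -/
open Finset in
/-- If every `b ∈ G` is related to a proportion at least `p` of the elements of `F`, then some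
`m` elements of `F` leave at most a proportion `(1 - p) ^ m` of `G` uncovered. -/
theorem exists_subset_card_uncovered_le {α β : Type*} [DecidableEq α]
    (F : Finset α) (G : Finset β) (R : α → β → Prop) [∀ a b, Decidable (R a b)] (p : ℝ)
    (hp : p ≤ 1) (hF : F.Nonempty)
    (h : ∀ b ∈ G, p * #F ≤ #{a ∈ F | R a b}) (m : ℕ) :
    ∃ T ⊆ F, #T ≤ m ∧ (#{b ∈ G | ∀ a ∈ T, ¬ R a b} : ℝ) ≤ (1 - p) ^ m * #G := by
  induction m with
  | zero => exact ⟨∅, by simp, by simp, by simp⟩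
  | succ m ih =>
    obtain ⟨T, hTF, hTm, hT⟩ := ih
    set U : Finset β := {b ∈ G | ∀ a ∈ T, ¬ R a b} with hU
    have hdouble : ∑ a ∈ F, (#{b ∈ U | R a b} : ℝ) = ∑ b ∈ U, (#{a ∈ F | R a b} : ℝ) := by
      exact_mod_cast sum_card_bipartiteAbove_eq_sum_card_bipartiteBelow (s := F) (t := U) R
    have hsum : ∑ _a ∈ F, p * (#U : ℝ) ≤ ∑ a ∈ F, (#{b ∈ U | R a b} : ℝ) := by
      rw [hdouble]
      calc ∑ _a ∈ F, p * (#U : ℝ) = ∑ _b ∈ U, p * (#F : ℝ) := by simp; ring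
        _ ≤ _ := sum_le_sum fun b hb => h b (mem_filter.mp hb).1
    obtain ⟨a, haF, ha⟩ := exists_le_of_sum_le hF hsum
    refine ⟨insert a T, insert_subset haF hTF, (card_insert_le _ _).trans (by omega), ?_⟩
    have hset : ({b ∈ G | ∀ c ∈ insert a T, ¬ R c b} : Finset β) = {b ∈ U | ¬ R a b} := by
      ext b
      simp only [hU, mem_filter, mem_insert, forall_eq_or_imp]
      tauto
    have hsplit : (#{b ∈ U | R a b} : ℝ) + #{b ∈ U | ¬ R a b} = #U := by
      exact_mod_cast card_filter_add_card_filter_not (s := U) (fun b => R a b)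
    rw [hset]
    have hmul := mul_le_mul_of_nonneg_left hT (sub_nonneg.mpr hp)
    rw [pow_succ]
    linarith

open Finset in
theorem exists_subset_card_le_forall_exists {α β : Type*} [DecidableEq α]
    (F : Finset α) (G : Finset β) (R : α → β → Prop) [∀ a b, Decidable (R a b)] (p : ℝ)
    (hp : p ≤ 1) (hF : F.Nonempty)
    (h : ∀ b ∈ G, p * #F ≤ #{a ∈ F | R a b}) (m : ℕ) (hm : (1 - p) ^ m * #G < 1) :
    ∃ T ⊆ F, #T ≤ m ∧ ∀ b ∈ G, ∃ a ∈ T, R a b := by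
  obtain ⟨T, hTF, hTm, hT⟩ := exists_subset_card_uncovered_le F G R p hp hF h m
  refine ⟨T, hTF, hTm, fun b hb => ?_⟩
  by_contra! hcon
  refine absurd (hT.trans_lt hm) (not_lt.mpr ?_)
  rw [Nat.one_le_cast, Nat.one_le_iff_ne_zero, card_ne_zero]
  exact ⟨b, mem_filter.mpr ⟨hb, hcon⟩⟩

open Finset in
theorem choose_mul_choose_le_card_filter_inter {α : Type*} [Fintype α] [DecidableEq α]
    (S' : Finset α) {k N : ℕ} (hk : k ≤ N) :
    (#S').choose k * (Fintype.card α - #S').choose (N - k) ≤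
      #{S ∈ powersetCard N (univ : Finset α) | k ≤ #(S ∩ S')} := by
  rw [← card_compl, ← card_powersetCard, ← card_powersetCard, ← card_product]
  have inter_eq {A B : Finset α} (hA : A ⊆ S') (hB : B ⊆ S'ᶜ) : (A ∪ B) ∩ S' = A := by
    ext x
    have h₁ := @hA x
    have h₂ := @hB x
    simp only [mem_inter, mem_union, mem_compl] at *
    tauto
  have sdiff_eq {A B : Finset α} (hA : A ⊆ S') (hB : B ⊆ S'ᶜ) : (A ∪ B) \ S' = B := by
    ext x
    have h₁ := @hA x
    have h₂ := @hB x
    simp only [mem_sdiff, mem_union, mem_compl] at *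
    tauto
  refine card_le_card_of_injOn (fun q => q.1 ∪ q.2) ?_ ?_
  · rintro ⟨A, B⟩ hq
    simp only [coe_product, Set.mem_prod, mem_coe, mem_powersetCard] at hq
    obtain ⟨⟨hA, hAk⟩, hB, hBk⟩ := hq
    have hdisj : Disjoint A B :=
      disjoint_of_subset_left hA (disjoint_of_subset_right hB disjoint_compl_right)
    simp only [coe_filter, mem_powersetCard, Set.mem_ofPred_eq, subset_univ, true_and]
    rw [card_union_of_disjoint hdisj, inter_eq hA hB]
    omega
  · rintro ⟨A, B⟩ hq ⟨A', B'⟩ hq' heq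
    simp only [coe_product, Set.mem_prod, mem_coe, mem_powersetCard] at hq hq' heq
    rw [Prod.mk.injEq]
    constructor
    · rw [← inter_eq hq.1.1 hq.2.1, heq, inter_eq hq'.1.1 hq'.2.1]
    · rw [← sdiff_eq hq.1.1 hq.2.1, heq, sdiff_eq hq'.1.1 hq'.2.1]

theorem sq_pow_le_exp_mul_pow {N j : ℕ} (hN : 4 ≤ N) (hj : j ≤ N) :
    ((N : ℝ) ^ 2) ^ j ≤ Real.exp 4 * ((N : ℝ) ^ 2 - 2 * N) ^ j := by
  have hN' : (4 : ℝ) ≤ N := by exact_mod_cast hN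
  have hj' : (j : ℝ) ≤ N := by exact_mod_cast hj
  have hbase : (N : ℝ) ^ 2 ≤ Real.exp (4 / N) * ((N : ℝ) ^ 2 - 2 * N) := by
    have h₁ : 4 / (N : ℝ) + 1 ≤ Real.exp (4 / N) := Real.add_one_le_exp _
    have h₂ : (0 : ℝ) ≤ (N : ℝ) ^ 2 - 2 * N := by nlinarith
    refine le_trans ?_ (mul_le_mul_of_nonneg_right h₁ h₂)
    have h₃ : (4 / (N : ℝ) + 1) * ((N : ℝ) ^ 2 - 2 * N) = (N : ℝ) ^ 2 + 2 * N - 8 := by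
      field_simp
      ring
    rw [h₃]
    linarith
  calc ((N : ℝ) ^ 2) ^ j ≤ (Real.exp (4 / N) * ((N : ℝ) ^ 2 - 2 * N)) ^ j :=
        pow_le_pow_left₀ (by positivity) hbase j
    _ = Real.exp (j * (4 / N)) * ((N : ℝ) ^ 2 - 2 * N) ^ j := by rw [mul_pow, Real.exp_nat_mul]
    _ ≤ _ := by
      gcongr
      · exact pow_nonneg (by nlinarith) j
      · rw [mul_div_assoc', div_le_iff₀ (by linarith)]
        linarith

theorem choose_sq_le {N k : ℕ} (hN : 4 ≤ N) (hk : 2 * k ≤ N) :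
    ((N ^ 2).choose N : ℝ) ≤ Real.exp 4 * (4 * k) ^ k *
      ((N.choose k : ℝ) * ((N ^ 2 - N).choose (N - k) : ℝ)) := by
  have hkN : k ≤ N := by omega
  have hN' : (4 : ℝ) ≤ N := by exact_mod_cast hN
  have hk' : 2 * (k : ℝ) ≤ N := by exact_mod_cast hk
  set j := N - k with hj
  set D : ℝ := (N.descFactorial k : ℝ) with hD
  set f : ℝ := (j.factorial : ℝ) with hf
  have hf0 : 0 < f := by rw [hf]; exact_mod_cast j.factorial_pos
  have hfact : f * D = (N.factorial : ℝ) := by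
    rw [hf, hD]
    exact_mod_cast Nat.factorial_mul_descFactorial hkN
  have hDle : ((N : ℝ) / 2) ^ k ≤ D := by
    have h₁ : ((N + 1 - k : ℕ) : ℝ) ^ k ≤ D := by
      rw [hD]
      exact_mod_cast Nat.pow_sub_le_descFactorial N k
    refine le_trans (pow_le_pow_left₀ (by positivity) ?_ k) h₁
    rw [Nat.cast_sub (by omega)]
    push_cast
    linarith
  have hDpos : 0 < D := lt_of_lt_of_le (by positivity) hDle
  have hE : ((N : ℝ) ^ 2 - 2 * N) ^ j ≤ f * ((N ^ 2 - N).choose j : ℝ) := by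
    have h₁ : ((N ^ 2 - N + 1 - j : ℕ) : ℝ) ^ j ≤ ((N ^ 2 - N).descFactorial j : ℝ) := by
      exact_mod_cast Nat.pow_sub_le_descFactorial (N ^ 2 - N) j
    have h₂ : ((N ^ 2 - N).descFactorial j : ℝ) = f * ((N ^ 2 - N).choose j : ℝ) := by
      rw [hf]
      exact_mod_cast Nat.descFactorial_eq_factorial_mul_choose _ _
    rw [← h₂]
    refine le_trans (pow_le_pow_left₀ (by nlinarith) ?_ j) h₁
    have h₃ : N * 4 ≤ N ^ 2 := by nlinarith
    have h₄ : (j : ℝ) ≤ N := by exact_mod_cast (Nat.sub_le N k)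
    rw [Nat.cast_sub (by omega), Nat.cast_add, Nat.cast_sub (by omega)]
    push_cast
    linarith
  have hC : D ≤ (k : ℝ) ^ k * (N.choose k : ℝ) := by
    have h₁ : D = (k.factorial : ℝ) * (N.choose k : ℝ) := by
      rw [hD]
      exact_mod_cast Nat.descFactorial_eq_factorial_mul_choose _ _
    rw [h₁]
    gcongr
    exact_mod_cast Nat.factorial_le_pow k
  have hB : f * D * ((N ^ 2).choose N : ℝ) ≤ ((N : ℝ) ^ 2) ^ N := by
    rw [hfact]
    exact_mod_cast (Nat.descFactorial_eq_factorial_mul_choose (N ^ 2) N) ▸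
      Nat.descFactorial_le_pow (N ^ 2) N
  have hsplit : ((N : ℝ) ^ 2) ^ N = 4 ^ k * (((N : ℝ) / 2) ^ k * ((N : ℝ) / 2) ^ k) *
      ((N : ℝ) ^ 2) ^ j := by
    rw [← mul_pow, ← mul_pow, show (4 : ℝ) * (N / 2 * (N / 2)) = (N : ℝ) ^ 2 by ring, ← pow_add]
    congr 1
    omega
  have hmain : f * D * ((N ^ 2).choose N : ℝ) ≤ f * D * (Real.exp 4 * (4 * k) ^ k *
      ((N.choose k : ℝ) * ((N ^ 2 - N).choose j : ℝ))) := by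
    calc f * D * ((N ^ 2).choose N : ℝ) ≤ _ := hB
      _ = _ := hsplit
      _ ≤ 4 ^ k * (D * ((k : ℝ) ^ k * (N.choose k : ℝ))) *
          (Real.exp 4 * (f * ((N ^ 2 - N).choose j : ℝ))) := by
        gcongr
        · exact hDle.trans hC
        · exact (sq_pow_le_exp_mul_pow hN (Nat.sub_le N k)).trans (by gcongr)
      _ = _ := by rw [mul_pow]; ring
  exact le_of_mul_le_mul_left hmain (by positivity)

open Filter in
theorem eventually_loglog_bounds (s : ℝ) (hs : 0 < s) :
    ∀ᶠ N : ℕ in atTop, 4 ≤ N ∧ 1 ≤ Real.log (Real.log N) ∧ 1 ≤ Real.log N ∧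
      2 * (s * Real.log N + 1) ≤ N ∧
      Real.log (8 * s) + 1 ≤ Real.log (Real.log (Real.log N)) ∧
      2 * Real.log (Real.log N) + 10 < s * Real.log N / Real.log (Real.log N) := by
  have hcast : Tendsto (fun N : ℕ => (N : ℝ)) atTop atTop := tendsto_natCast_atTop_atTop
  have hlog := Real.tendsto_log_atTop.comp hcast
  have hloglog := Real.tendsto_log_atTop.comp hlog
  have hlogloglog := Real.tendsto_log_atTop.comp hloglog
  have hlin : ∀ᶠ x : ℝ in atTop, 2 * (s * Real.log x + 1) ≤ x := by
    have h := Real.isLittleO_log_id_atTop.bound (show (0 : ℝ) < 1 / (4 * s) by positivity)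
    filter_upwards [h, eventually_ge_atTop 4] with x hx hx4
    have h₁ : Real.log x ≤ 1 / (4 * s) * x := by
      have := (le_abs_self _).trans hx
      rwa [id, Real.norm_of_nonneg (by linarith)] at this
    have h₂ : s * Real.log x ≤ x / 4 := by
      calc s * Real.log x ≤ s * (1 / (4 * s) * x) := by gcongr
        _ = x / 4 := by field_simp
    linarith
  have hexp : ∀ᶠ L : ℝ in atTop, 2 * Real.log L + 10 < s * L / Real.log L := by
    have h := (Real.isLittleO_pow_log_id_atTop (n := 2)).bound
      (show (0 : ℝ) < s / 24 by positivity)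
    filter_upwards [h, eventually_ge_atTop (Real.exp 1)] with L hL hL1
    have hLpos : 0 < L := (Real.exp_pos 1).trans_le hL1
    have h₁ : 1 ≤ Real.log L := (Real.le_log_iff_exp_le hLpos).mpr hL1
    have h₂ : Real.log L ^ 2 ≤ s / 24 * L := by
      have := (le_abs_self _).trans hL
      rwa [id, Real.norm_of_nonneg hLpos.le] at this
    rw [lt_div_iff₀ (by linarith)]
    nlinarith
  filter_upwards [eventually_ge_atTop 4, hloglog.eventually_ge_atTop 1,
    hlog.eventually_ge_atTop 1, hcast.eventually hlin,
    hlogloglog.eventually_ge_atTop (Real.log (8 * s) + 1), hlog.eventually hexp]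
    with N h₁ h₂ h₃ h₄ h₅ h₆
  exact ⟨h₁, h₂, h₃, h₄, h₅, h₆⟩

/-- For large `L`, the quantity `log ((4k)^k)` with `k ≤ s L / log L + 1` is smaller than `s L` by
more than `log L + 6`. -/
theorem mul_log_four_mul_lt {s L k : ℝ} (hs : 0 < s) (hL : 1 ≤ L) (hl : 1 ≤ Real.log L)
    (hll : Real.log (8 * s) + 1 ≤ Real.log (Real.log L))
    (hx : 2 * Real.log L + 10 < s * L / Real.log L) (hk : 0 < k)
    (hkx : k ≤ s * L / Real.log L + 1) (hxk : s * L / Real.log L ≤ k) :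
    k * Real.log (4 * k) + Real.log L + 6 < s * L := by
  set l := Real.log L with hldef
  have hl0 : 0 < l := by linarith
  have hlog : Real.log (4 * k) ≤ l - 1 := by
    calc Real.log (4 * k) ≤ Real.log (8 * s * L / l) := by
          apply Real.log_le_log (by positivity)
          have : 8 * s * L / l = 8 * (s * L / l) := by ring
          linarith
      _ = Real.log (8 * s) + l - Real.log l := by
          rw [Real.log_div (by positivity) hl0.ne', Real.log_mul (by positivity) (by positivity)]
      _ ≤ l - 1 := by linarith
  have h₁ : k * Real.log (4 * k) ≤ k * (l - 1) := by gcongr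
  have h₂ : k * l ≤ s * L + l := by
    calc k * l ≤ (s * L / l + 1) * l := by gcongr
      _ = s * L + l := by field_simp
  nlinarith

open Finset in
/-- For every `s > 0` there is `N₀` such that for every `N ≥ N₀` there are a
set `X` with `|X| = N²` and a family `𝒮` of `N`-element subsets of `X` with
`|𝒮| ≤ N^(1+s)` such that every `N`-element subset `S' ⊆ X` meets some `S ∈ 𝒮` in at
least `s·log N / log log N` elements. -/
theorem stmt7 (s : ℝ) (hs : 0 < s) :
    ∃ N₀ : ℕ, ∀ N : ℕ, N₀ ≤ N →
      ∃ 𝒮 : Finset (Finset (Fin (N ^ 2))),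
        (∀ S ∈ 𝒮, S.card = N) ∧
        (𝒮.card : ℝ) ≤ (N : ℝ) ^ ((1 : ℝ) + s) ∧
        ∀ S' : Finset (Fin (N ^ 2)), S'.card = N →
          ∃ S ∈ 𝒮, s * Real.log N / Real.log (Real.log N) ≤ ((S ∩ S').card : ℝ) := by
  obtain ⟨N₀, hN₀⟩ := Filter.eventually_atTop.mp (eventually_loglog_bounds s hs)
  refine ⟨N₀, fun N hN => ?_⟩
  obtain ⟨hN4, hl, hL, hlin, hll, hx⟩ := hN₀ N hN
  set L := Real.log N with hLdef
  set l := Real.log L with hldef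
  set x := s * L / l with hxdef
  set k := ⌈x⌉₊ with hkdef
  have hx0 : 0 < x := by linarith
  have hNpos : (0 : ℝ) < N := by exact_mod_cast (by omega : 0 < N)
  have hkpos : 0 < k := Nat.ceil_pos.mpr hx0
  have hkpos' : (0 : ℝ) < k := by exact_mod_cast hkpos
  have hkx : (k : ℝ) ≤ x + 1 := (Nat.ceil_lt_add_one hx0.le).le
  have hxL : x ≤ s * L := div_le_self (by positivity) hl
  have hkN : 2 * k ≤ N := by
    have : 2 * (k : ℝ) ≤ N := by linarith
    exact_mod_cast this
  have hmain := mul_log_four_mul_lt hs hL hl hll hx hkpos' hkx (Nat.le_ceil x)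
  set q : ℝ := Real.exp 4 * (4 * k) ^ k with hq
  have hqpos : 0 < q := by positivity
  have hqexp : q = Real.exp (4 + k * Real.log (4 * k)) := by
    rw [hq, Real.exp_add, Real.exp_nat_mul, Real.exp_log (by positivity)]
  have hq1 : 1 ≤ q := by
    rw [hqexp, Real.one_le_exp_iff]
    have : 0 ≤ Real.log (4 * (k : ℝ)) := by
      apply Real.log_nonneg
      have : (1 : ℝ) ≤ k := by exact_mod_cast hkpos
      linarith
    positivity
  set F := powersetCard N (univ : Finset (Fin (N ^ 2))) with hFdef
  have hFcard : #F = (N ^ 2).choose N := by simp [hFdef]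
  have hFpos : 0 < #F := by rw [hFcard]; exact Nat.choose_pos (by nlinarith)
  have hdense : ∀ S' ∈ F, q⁻¹ * #F ≤ #{S ∈ F | k ≤ #(S ∩ S')} := by
    intro S' hS'
    have hS'N : #S' = N := (mem_powersetCard.mp hS').2
    have h₁ := choose_mul_choose_le_card_filter_inter S' (show k ≤ N by omega)
    rw [hS'N, Fintype.card_fin] at h₁
    have h₂ : (N.choose k : ℝ) * ((N ^ 2 - N).choose (N - k) : ℝ) ≤
        #{S ∈ F | k ≤ #(S ∩ S')} := by exact_mod_cast h₁
    rw [inv_mul_le_iff₀ hqpos, hFcard]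
    exact (choose_sq_le hN4 hkN).trans (by gcongr)
  set m := ⌊(N : ℝ) ^ (1 + s)⌋₊ with hm
  have hpow1 : (1 : ℝ) ≤ (N : ℝ) ^ (1 + s) :=
    Real.one_le_rpow (by exact_mod_cast (by omega : 1 ≤ N)) (by linarith)
  have hmge : (N : ℝ) ^ (1 + s) ≤ 2 * m := by
    have h₁ := Nat.lt_floor_add_one ((N : ℝ) ^ (1 + s))
    have h₂ : (1 : ℝ) ≤ m := by exact_mod_cast Nat.le_floor (by simpa using hpow1)
    linarith
  have hmq : 2 * N * L < m * q⁻¹ := by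
    rw [← div_eq_mul_inv, lt_div_iff₀ hqpos]
    have hexp2 : (4 : ℝ) ≤ Real.exp 2 := by
      have h := Real.add_one_le_exp (1 : ℝ)
      have h' : Real.exp 2 = Real.exp 1 * Real.exp 1 := by rw [← Real.exp_add]; norm_num
      nlinarith
    have hNexp : (N : ℝ) = Real.exp L := (Real.exp_log hNpos).symm
    have hLexp : L = Real.exp l := (Real.exp_log (by linarith)).symm
    have h₁ : 4 * N * L * q ≤ Real.exp (2 + L + l + (4 + k * Real.log (4 * k))) := by
      rw [Real.exp_add, Real.exp_add, Real.exp_add, ← hNexp, ← hLexp, ← hqexp]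
      gcongr
    have h₂ : Real.exp (2 + L + l + (4 + k * Real.log (4 * k))) < (N : ℝ) ^ (1 + s) := by
      rw [Real.rpow_def_of_pos hNpos, Real.exp_lt_exp]
      linarith
    linarith
  have hsmall : (1 - q⁻¹) ^ m * (#F : ℝ) < 1 := by
    have h₁ : (1 - q⁻¹) ^ m ≤ Real.exp (-(m * q⁻¹)) := by
      rw [← mul_neg, Real.exp_nat_mul]
      refine pow_le_pow_left₀ (sub_nonneg.mpr (inv_le_one_of_one_le₀ hq1)) ?_ m
      exact Real.one_sub_le_exp_neg _
    have h₂ : (#F : ℝ) ≤ Real.exp (2 * N * L) := by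
      have h₃ : (#F : ℝ) ≤ ((N : ℝ) ^ 2) ^ N := by
        rw [hFcard]
        exact_mod_cast Nat.choose_le_pow (N ^ 2) N
      refine h₃.trans_eq ?_
      rw [← pow_mul, ← Real.exp_log (pow_pos hNpos (2 * N)), Real.log_pow]
      push_cast
      rfl
    calc _ ≤ Real.exp (-(m * q⁻¹)) * Real.exp (2 * N * L) := by gcongr
      _ < 1 := by
        rw [← Real.exp_add, Real.exp_lt_one_iff]
        linarith
  obtain ⟨T, hTF, hTm, hT⟩ := exists_subset_card_le_forall_exists F F
    (fun S S' => k ≤ #(S ∩ S')) q⁻¹ (inv_le_one_of_one_le₀ hq1) (card_pos.mp hFpos) hdense m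
    hsmall
  refine ⟨T, fun S hS => (mem_powersetCard.mp (hTF hS)).2, ?_, fun S' hS' => ?_⟩
  · exact (Nat.cast_le.mpr hTm).trans (Nat.floor_le (by positivity))
  · obtain ⟨S, hS, hle⟩ := hT S' (mem_powersetCard.mpr ⟨subset_univ _, hS'⟩)
    exact ⟨S, hS, Nat.ceil_le.mp hle⟩
end

section
/- For all integers m ≥ 1 and N with m³ ≤ N, one has m^m ≤ (Nm choose m)/(N choose m) ≤ 3·m^m. -/
theorem pow_mul_descFactorial_le_descFactorial_mul {c : ℕ} (hc : 1 ≤ c) (n k : ℕ) :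
    c ^ k * n.descFactorial k ≤ (n * c).descFactorial k := by
  induction k with
  | zero => simp
  | succ k ih =>
    rw [Nat.descFactorial_succ, Nat.descFactorial_succ]
    have h : c * (n - k) ≤ n * c - k := by
      rw [Nat.mul_sub, mul_comm c n]
      exact Nat.sub_le_sub_left (Nat.le_mul_of_pos_left k hc) _
    calc c ^ (k + 1) * ((n - k) * n.descFactorial k)
        = (c * (n - k)) * (c ^ k * n.descFactorial k) := by ring
      _ ≤ (n * c - k) * (n * c).descFactorial k := Nat.mul_le_mul h ih

/-- By Bernoulli's inequality, the falling factorial is comparable to the power. -/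
theorem pow_le_three_mul_descFactorial {m n : ℕ} (hm : 1 ≤ m) (hmn : m ^ 3 ≤ n) :
    (n : ℝ) ^ m ≤ 3 * (n.descFactorial m : ℝ) := by
  have hle : m ≤ n := (Nat.le_self_pow (by norm_num) m).trans hmn
  have hm' : (1 : ℝ) ≤ m := by exact_mod_cast hm
  have hle' : (m : ℝ) ≤ n := by exact_mod_cast hle
  have hmn' : (m : ℝ) ^ 3 ≤ n := by exact_mod_cast hmn
  have hn : (0 : ℝ) < n := by linarith
  have hdesc : ((n : ℝ) + 1 - m) ^ m ≤ n.descFactorial m := by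
    have h := Nat.pow_sub_le_descFactorial n m
    have h' : ((n + 1 - m : ℕ) : ℝ) ^ m ≤ n.descFactorial m := by exact_mod_cast h
    rwa [Nat.cast_sub (by omega), Nat.cast_add, Nat.cast_one] at h'
  have hsmall : (m : ℝ) * ((m - 1) / n) ≤ 2 / 3 := by
    rw [← mul_div_assoc, div_le_iff₀ hn]
    nlinarith [mul_nonneg (by linarith : (0 : ℝ) ≤ m) (sq_nonneg ((m : ℝ) - 3 / 4))]
  have hfrac : ((m : ℝ) - 1) / n ≤ 1 := by
    rw [div_le_one hn]
    linarith
  have hbern := one_add_mul_le_pow (a := -(((m : ℝ) - 1) / n)) (by linarith) m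
  have hfactor : (n : ℝ) + 1 - m = n * (1 + -(((m : ℝ) - 1) / n)) := by
    field_simp
    ring
  rw [hfactor, mul_pow] at hdesc
  have hpow : (0 : ℝ) < (n : ℝ) ^ m := by positivity
  nlinarith [mul_le_mul_of_nonneg_left hbern hpow.le]

/-- For all integers `m ≥ 1` and `N` with `m³ ≤ N`,
`m^m ≤ C(Nm, m)/C(N, m) ≤ 3·m^m`. -/
theorem stmt8 (m N : ℕ) (hm : 1 ≤ m) (hmN : m ^ 3 ≤ N) :
    (m : ℝ) ^ m ≤ ((N * m).choose m : ℝ) / (N.choose m : ℝ) ∧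
      ((N * m).choose m : ℝ) / (N.choose m : ℝ) ≤ 3 * (m : ℝ) ^ m := by
  have hle : m ≤ N := (Nat.le_self_pow (by norm_num) m).trans hmN
  have hdesc : (0 : ℝ) < N.descFactorial m := by
    exact_mod_cast Nat.pos_of_ne_zero (by simpa [Nat.descFactorial_eq_zero_iff_lt] using hle)
  have hfac : (m.factorial : ℝ) ≠ 0 := by exact_mod_cast m.factorial_ne_zero
  have hratio : ((N * m).choose m : ℝ) / (N.choose m : ℝ) =
      ((N * m).descFactorial m : ℝ) / (N.descFactorial m : ℝ) := by
    rw [Nat.descFactorial_eq_factorial_mul_choose, Nat.descFactorial_eq_factorial_mul_choose,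
      Nat.cast_mul, Nat.cast_mul, mul_div_mul_left _ _ hfac]
  rw [hratio, le_div_iff₀ hdesc, div_le_iff₀ hdesc]
  constructor
  · exact_mod_cast pow_mul_descFactorial_le_descFactorial_mul hm N m
  · calc ((N * m).descFactorial m : ℝ) ≤ ((N : ℝ) * m) ^ m := by
          exact_mod_cast Nat.descFactorial_le_pow (N * m) m
      _ = (m : ℝ) ^ m * (N : ℝ) ^ m := by rw [mul_pow, mul_comm]
      _ ≤ (m : ℝ) ^ m * (3 * (N.descFactorial m : ℝ)) := by
          gcongr
          exact pow_le_three_mul_descFactorial hm hmN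
      _ = 3 * (m : ℝ) ^ m * (N.descFactorial m : ℝ) := by ring
end

section
/- Let m ≥ 1 and N be integers with m ∣ N. Then there exists a family 𝒮 of N-element subsets of a set X of size N² with |𝒮| = (N/m)·(m² choose m) such that for every N-element subset S' ⊆ X there exists S ∈ 𝒮 with |S ∩ S'| ≥ m. -/
/-- The union of the sub-blocks `(b, c)`, `c ∈ T`, of the block `b`. -/
def subblockUnion {B C D : Type*} [Fintype D] (p : B × Finset C) : Finset (B × C × D) :=
  {p.1} ×ˢ p.2 ×ˢ Finset.univ

theorem mem_subblockUnion {B C D : Type*} [Fintype D] {p : B × Finset C} {x : B × C × D} :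
    x ∈ subblockUnion p ↔ x.1 = p.1 ∧ x.2.1 ∈ p.2 := by
  simp only [subblockUnion, Finset.mem_product, Finset.mem_singleton, Finset.mem_univ, and_true]

theorem card_subblockUnion {B C D : Type*} [Fintype D] (p : B × Finset C) :
    (subblockUnion p : Finset (B × C × D)).card = p.2.card * Fintype.card D := by
  simp [subblockUnion]

theorem subblockUnion_injOn {B C D : Type*} [Fintype D] [Nonempty D] :
    Set.InjOn (subblockUnion : B × Finset C → Finset (B × C × D)) {p | p.2.Nonempty} := by
  rintro ⟨b, T⟩ ⟨c, hc⟩ ⟨b', T'⟩ - h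
  obtain ⟨d⟩ := ‹Nonempty D›
  have key : ∀ x : B × C × D, (x.1 = b ∧ x.2.1 ∈ T) ↔ (x.1 = b' ∧ x.2.1 ∈ T') := fun x => by
    simpa only [mem_subblockUnion] using Finset.ext_iff.mp h x
  obtain rfl : b = b' := ((key (b, c, d)).mp ⟨rfl, hc⟩).1
  have hT : T = T' := Finset.ext fun a => by simpa using key (b, a, d)
  rw [hT]

/-- A set with at least `m` elements per block on average meets some union of `m` sub-blocks of
a common block in at least `m` elements. -/
theorem exists_le_card_subblockUnion_inter {B C D : Type*} [Fintype B] [Nonempty B] [Fintype C]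
    [Fintype D] [DecidableEq B] [DecidableEq C] [DecidableEq D] {m : ℕ} (hm : m ≤ Fintype.card C)
    (S : Finset (B × C × D)) (hS : Fintype.card B * m ≤ S.card) :
    ∃ p : B × Finset C, p.2.card = m ∧ m ≤ (subblockUnion p ∩ S).card := by
  obtain ⟨b, -, hb⟩ := Finset.exists_le_card_fiber_of_mul_le_card_of_maps_to
    (s := S) (t := Finset.univ) (f := Prod.fst) (fun _ _ => Finset.mem_univ _)
    Finset.univ_nonempty hS
  obtain ⟨U, hU, hUm⟩ := Finset.exists_subset_card_eq hb
  obtain ⟨T, hT, hTm⟩ := Finset.exists_superset_card_eq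
    (s := U.image fun x => x.2.1) (Finset.card_image_le.trans_eq hUm) hm
  refine ⟨(b, T), hTm, hUm.symm.le.trans (Finset.card_le_card fun x hx => ?_)⟩
  have hx' := Finset.mem_filter.mp (hU hx)
  exact Finset.mem_inter.mpr
    ⟨mem_subblockUnion.mpr ⟨hx'.2, hT (Finset.mem_image_of_mem _ hx)⟩, hx'.1⟩

/-- For integers `m ≥ 1` and `N ≥ 1` with `m ∣ N`, there is a family `𝒮` of
`N`-element subsets of a set of size `N²` with `|𝒮| = (N/m)·C(m², m)` such that every
`N`-element subset `S'` meets some `S ∈ 𝒮` in at least `m` elements. -/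
theorem stmt9 (m N : ℕ) (hm : 1 ≤ m) (hN : 1 ≤ N) (hdvd : m ∣ N) :
    ∃ 𝒮 : Finset (Finset (Fin (N ^ 2))),
      (∀ S ∈ 𝒮, S.card = N) ∧
      𝒮.card = (N / m) * (m ^ 2).choose m ∧
      ∀ S' : Finset (Fin (N ^ 2)), S'.card = N → ∃ S ∈ 𝒮, m ≤ (S ∩ S').card := by
  obtain ⟨k, rfl⟩ := hdvd
  have : NeZero k := ⟨by rintro rfl; simp at hN⟩
  have e : (Fin k × Fin (m ^ 2) × Fin k) ≃ Fin ((m * k) ^ 2) :=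
    Fintype.equivFinOfCardEq (by simp; ring)
  let P : Finset (Fin k × Finset (Fin (m ^ 2))) :=
    Finset.univ ×ˢ Finset.powersetCard m Finset.univ
  have mem_P {p} : p ∈ P ↔ p.2.card = m := by simp [P]
  refine ⟨P.image fun p => (subblockUnion p).map e.toEmbedding, ?_, ?_, fun S' hS' => ?_⟩
  · simp only [Finset.forall_mem_image]
    intro p hp
    rw [Finset.card_map, card_subblockUnion, mem_P.mp hp, Fintype.card_fin]
  · rw [Finset.card_image_of_injOn]
    · simp [P, Nat.mul_div_cancel_left k hm]
    · refine (Finset.map_injective _).comp_injOn (subblockUnion_injOn.mono fun p hp => ?_)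
      exact Finset.card_pos.mp (by rw [mem_P.mp hp]; exact hm)
  · obtain ⟨p, hp, hle⟩ := exists_le_card_subblockUnion_inter (m := m)
      (by simpa using Nat.le_self_pow two_ne_zero m) (S'.map e.symm.toEmbedding)
      (by simp [hS', mul_comm])
    refine ⟨_, Finset.mem_image_of_mem _ (mem_P.mpr hp), ?_⟩
    rwa [← Finset.card_map e.toEmbedding, Finset.map_inter, Finset.map_map,
      ← Equiv.trans_toEmbedding, Equiv.symm_trans_self, Equiv.refl_toEmbedding,
      Finset.map_refl] at hle
end

section
/- There exist absolute constants c₀ ∈ (0,1] and C > 0 such that for all positive integers N and K with K ≤ c₀·N, for every set X with |X| = N² and every family 𝒮 of N-element subsets of X with |𝒮| ≤ K·N, there exists an N-element subset S' ⊆ X such that |S ∩ S'| ≤ C·K for every S ∈ 𝒮. In particular, families of O(N) many N-sets satisfy C(𝒮) = O(1). -/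
open Finset in
/-- The `n`-element sets meeting every member of `𝒮` in at most `k` points. -/
def sparseSets {X : Type} [Fintype X] [DecidableEq X] (𝒮 : Finset (Finset X)) (k n : ℕ) :
    Finset (Finset X) :=
  (powersetCard n univ).filter fun A => ∀ S ∈ 𝒮, (S ∩ A).card ≤ k

section SparseSets

open Finset

variable {X : Type} [Fintype X] [DecidableEq X] {𝒮 : Finset (Finset X)} {k n N : ℕ}

theorem mem_sparseSets {A : Finset X} :
    A ∈ sparseSets 𝒮 k n ↔ A.card = n ∧ ∀ S ∈ 𝒮, (S ∩ A).card ≤ k := by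
  simp [sparseSets, mem_powersetCard]

/-- Pairs `(A, x)` with `A` sparse of size `n` and `x ∉ A`. -/
def sparseExtensions (𝒮 : Finset (Finset X)) (k n : ℕ) : Finset (Finset X × X) :=
  (sparseSets 𝒮 k n).biUnion fun A => Aᶜ.image fun x => (A, x)

theorem mem_sparseExtensions {p : Finset X × X} :
    p ∈ sparseExtensions 𝒮 k n ↔ p.1 ∈ sparseSets 𝒮 k n ∧ p.2 ∉ p.1 := by
  obtain ⟨A, x⟩ := p
  simp only [sparseExtensions, mem_biUnion, mem_image, mem_compl, Prod.mk.injEq]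
  constructor
  · rintro ⟨B, hB, y, hy, rfl, rfl⟩
    exact ⟨hB, hy⟩
  · rintro ⟨hA, hx⟩
    exact ⟨A, hA, x, hx, rfl, rfl⟩

theorem card_sparseExtensions :
    (sparseExtensions 𝒮 k n).card = (sparseSets 𝒮 k n).card * (Fintype.card X - n) := by
  rw [sparseExtensions, card_biUnion]
  · rw [sum_const_nat]
    intro A hA
    rw [card_image_of_injective _ (Prod.mk_right_injective A), card_compl,
      (mem_sparseSets.1 hA).1]
  · intro A _ B _ hAB
    rw [Function.onFun, Finset.disjoint_left]
    rintro p hp hq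
    obtain ⟨x, -, rfl⟩ := mem_image.1 hp
    obtain ⟨y, -, h⟩ := mem_image.1 hq
    exact hAB (Prod.mk.inj h).1.symm

theorem card_filter_insert_mem_sparseSets_le :
    ((sparseExtensions 𝒮 k n).filter fun p => insert p.2 p.1 ∈ sparseSets 𝒮 k (n + 1)).card ≤
      (sparseSets 𝒮 k (n + 1)).card * (n + 1) := by
  calc
    _ ≤ ((sparseSets 𝒮 k (n + 1)).biUnion fun A => A.image fun x => (A.erase x, x)).card := by
      apply card_le_card
      rintro ⟨A, x⟩ hp
      obtain ⟨hp, h⟩ := mem_filter.1 hp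
      refine mem_biUnion.2 ⟨_, h, mem_image.2 ⟨x, mem_insert_self _ _, ?_⟩⟩
      rw [erase_insert (mem_sparseExtensions.1 hp).2]
    _ ≤ _ := card_biUnion_le_card_mul _ _ _ fun A hA =>
      card_image_le.trans (mem_sparseSets.1 hA).1.le

theorem card_filter_insert_notMem_sparseSets_le (h𝒮 : ∀ S ∈ 𝒮, S.card = N) (hkn : k ≤ n) :
    ((sparseExtensions 𝒮 k n).filter fun p => insert p.2 p.1 ∉ sparseSets 𝒮 k (n + 1)).card ≤
      𝒮.card * (N.choose (k + 1) * ((k + 1) * (sparseSets 𝒮 k (n - k)).card)) := by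
  calc
    _ ≤ (𝒮.biUnion fun S => (powersetCard (k + 1) S).biUnion fun T => T.biUnion fun x =>
          (sparseSets 𝒮 k (n - k)).image fun B => (B ∪ T.erase x, x)).card := by
      apply card_le_card
      rintro ⟨A, x⟩ hp
      obtain ⟨hp, h⟩ := mem_filter.1 hp
      obtain ⟨hA, hx⟩ := mem_sparseExtensions.1 hp
      simp only at h hA hx
      obtain ⟨hAn, hAk⟩ := mem_sparseSets.1 hA
      rw [mem_sparseSets, card_insert_of_notMem hx, hAn] at h
      push Not at h
      obtain ⟨S, hS, hSk⟩ := h rfl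
      obtain ⟨T, hT, hTk⟩ := exists_subset_card_eq (Nat.succ_le_of_lt hSk)
      have hTS : T ⊆ S := hT.trans inter_subset_left
      have hTA : T ⊆ insert x A := hT.trans inter_subset_right
      have hxT : x ∈ T := by
        by_contra hxT
        have : T ⊆ S ∩ A := subset_inter hTS ((subset_insert_iff_of_notMem hxT).1 hTA)
        have := card_le_card this
        have := hAk S hS
        omega
      have hTA' : T.erase x ⊆ A := subset_insert_iff.1 hTA
      simp only [mem_biUnion, mem_image]
      refine ⟨S, hS, T, mem_powersetCard.2 ⟨hTS, hTk⟩, x, hxT, A \ T.erase x,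
        mem_sparseSets.2 ⟨?_, fun S' hS' => ?_⟩, ?_⟩
      · rw [card_sdiff_of_subset hTA', card_erase_of_mem hxT, hAn, hTk]
        omega
      · exact (card_le_card (inter_subset_inter_left sdiff_subset)).trans (hAk S' hS')
      · rw [sdiff_union_of_subset hTA']
    _ ≤ _ := by
      refine card_biUnion_le_card_mul _ _ _ fun S hS => ?_
      rw [← h𝒮 S hS, ← card_powersetCard]
      refine card_biUnion_le_card_mul _ _ _ fun T hT => ?_
      rw [← (mem_powersetCard.1 hT).2]
      exact card_biUnion_le_card_mul _ _ _ fun x _ => card_image_le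

theorem filter_insert_notMem_sparseSets_eq_empty (hnk : n < k) :
    ((sparseExtensions 𝒮 k n).filter fun p => insert p.2 p.1 ∉ sparseSets 𝒮 k (n + 1)) = ∅ := by
  refine filter_eq_empty_iff.2 fun p hp => not_not.2 ?_
  obtain ⟨hA, hx⟩ := mem_sparseExtensions.1 hp
  have hcard : (insert p.2 p.1).card = n + 1 := by
    rw [card_insert_of_notMem hx, (mem_sparseSets.1 hA).1]
  refine mem_sparseSets.2 ⟨hcard, fun S _ => ?_⟩
  have := card_le_card (inter_subset_right : S ∩ insert p.2 p.1 ⊆ _)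
  omega

theorem pow_mul_le_of_forall_mul_le {g : ℕ → ℕ} {a b : ℕ} :
    ∀ {j n : ℕ}, j ≤ n → (∀ i < n, a * g i ≤ b * g (i + 1)) → a ^ j * g (n - j) ≤ b ^ j * g n
  | 0, _, _, _ => by simp
  | j + 1, n, hj, h => by
    have ih := pow_mul_le_of_forall_mul_le (j := j) (n := n) (by omega) h
    have hstep := h (n - (j + 1)) (by omega)
    rw [show n - (j + 1) + 1 = n - j by omega] at hstep
    calc
      a ^ (j + 1) * g (n - (j + 1)) = a ^ j * (a * g (n - (j + 1))) := by ring
      _ ≤ a ^ j * (b * g (n - j)) := by gcongr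
      _ = b * (a ^ j * g (n - j)) := by ring
      _ ≤ b * (b ^ j * g n) := by gcongr
      _ = _ := by ring

/-- The number of sparse sets grows by a factor of at least `N / 4` at each size below `N`. -/
theorem mul_card_sparseSets_le {K : ℕ} (hX : Fintype.card X = N ^ 2)
    (h𝒮 : ∀ S ∈ 𝒮, S.card = N) (hcard : 𝒮.card ≤ K * N) (hk : 4 ^ (k + 1) * K ≤ k.factorial)
    (hn : n < N) :
    N * (sparseSets 𝒮 k n).card ≤ 4 * (sparseSets 𝒮 k (n + 1)).card := by
  induction n using Nat.strong_induction_on with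
  | _ n ih =>
  set g : ℕ → ℕ := fun i => (sparseSets 𝒮 k i).card with hg
  set bad := ((sparseExtensions 𝒮 k n).filter fun p =>
    insert p.2 p.1 ∉ sparseSets 𝒮 k (n + 1)).card with hbad
  have hbad_le : 4 * bad ≤ N ^ 2 * g n := by
    rcases lt_or_ge n k with hnk | hkn
    · rw [hbad, filter_insert_notMem_sparseSets_eq_empty hnk]
      simp
    · have hpow : N ^ k * g (n - k) ≤ 4 ^ k * g n :=
        pow_mul_le_of_forall_mul_le hkn fun i hi => ih i hi (hi.trans hn)
      have hchoose : N.choose (k + 1) * (k + 1) * k.factorial ≤ N ^ (k + 1) := by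
        have := Nat.descFactorial_eq_factorial_mul_choose N (k + 1)
        rw [Nat.factorial_succ] at this
        calc
          _ = N.descFactorial (k + 1) := by rw [this]; ring
          _ ≤ _ := Nat.descFactorial_le_pow _ _
      refine Nat.le_of_mul_le_mul_right ?_ k.factorial_pos
      calc
        4 * bad * k.factorial
          ≤ 4 * (𝒮.card * (N.choose (k + 1) * ((k + 1) * g (n - k)))) * k.factorial := by
            gcongr
            exact card_filter_insert_notMem_sparseSets_le h𝒮 hkn
        _ = 4 * 𝒮.card * (N.choose (k + 1) * (k + 1) * k.factorial) * g (n - k) := by ring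
        _ ≤ 4 * (K * N) * N ^ (k + 1) * g (n - k) := by gcongr
        _ = 4 * K * N ^ 2 * (N ^ k * g (n - k)) := by ring
        _ ≤ 4 * K * N ^ 2 * (4 ^ k * g n) := by gcongr
        _ = N ^ 2 * g n * (4 ^ (k + 1) * K) := by ring
        _ ≤ N ^ 2 * g n * k.factorial := by gcongr
  have hsplit : g n * (N ^ 2 - n) ≤ g (n + 1) * (n + 1) + bad := by
    rw [← hX, hg, ← card_sparseExtensions, hbad,
      ← card_filter_add_card_filter_not fun p => insert p.2 p.1 ∈ sparseSets 𝒮 k (n + 1)]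
    gcongr
    exact card_filter_insert_mem_sparseSets_le
  have hhalf : N ^ 2 ≤ 2 * (N ^ 2 - n) := by
    have : 2 * n ≤ N ^ 2 := by
      rcases Nat.lt_or_ge N 2 with h | h
      · have : n = 0 := by omega
        simp [this]
      · nlinarith
    omega
  have hmain : N * (N * g n) ≤ N * (4 * g (n + 1)) := by
    have h₁ := Nat.mul_le_mul_left (g n) hhalf
    have h₂ : g (n + 1) * (n + 1) ≤ g (n + 1) * N := Nat.mul_le_mul_left _ hn
    nlinarith
  exact Nat.le_of_mul_le_mul_left hmain (by omega)

end SparseSets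

theorem four_pow_succ_mul_self_le_factorial {k : ℕ} (hk : 16 ≤ k) :
    4 ^ (k + 1) * k ≤ k.factorial := by
  induction k, hk using Nat.le_induction with
  | base => decide
  | succ k hk ih =>
    rw [Nat.factorial_succ, mul_comm (4 ^ _)]
    refine Nat.mul_le_mul_left _ (le_trans ?_ ih)
    rw [pow_succ 4 (k + 1)]
    exact Nat.mul_le_mul_left _ (by omega)

/-- There are absolute constants `c₀ ∈ (0,1]` and `C > 0` such that for all
positive integers `N, K` with `K ≤ c₀·N`, every set `X` with `|X| = N²` and every family
`𝒮` of `N`-element subsets of `X` with `|𝒮| ≤ K·N` admit an `N`-element subset `S' ⊆ X`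
with `|S ∩ S'| ≤ C·K` for every `S ∈ 𝒮`. -/
theorem stmt10 :
    ∃ c₀ : ℝ, 0 < c₀ ∧ c₀ ≤ 1 ∧
      ∃ C : ℝ, 0 < C ∧
        ∀ N K : ℕ, 0 < N → 0 < K → (K : ℝ) ≤ c₀ * N →
          ∀ (X : Type) [Fintype X] [DecidableEq X] (𝒮 : Finset (Finset X)),
            Fintype.card X = N ^ 2 →
            (∀ S ∈ 𝒮, S.card = N) →
            𝒮.card ≤ K * N →
            ∃ S' : Finset X, S'.card = N ∧
              ∀ S ∈ 𝒮, ((S ∩ S').card : ℝ) ≤ C * K := by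
  refine ⟨1, one_pos, le_rfl, 16, by norm_num, fun N K hN hK _ X _ _ 𝒮 hX h𝒮 hcard => ?_⟩
  have hk : 4 ^ (16 * K + 1) * K ≤ (16 * K).factorial :=
    (Nat.mul_le_mul_left _ (by omega)).trans
      (four_pow_succ_mul_self_le_factorial (k := 16 * K) (by omega))
  have hpos : ∀ n ≤ N, 0 < (sparseSets 𝒮 (16 * K) n).card := by
    intro n
    induction n with
    | zero => exact fun _ => Finset.card_pos.2 ⟨∅, mem_sparseSets.2 (by simp)⟩
    | succ n ih =>
      intro hn
      have := mul_card_sparseSets_le hX h𝒮 hcard hk hn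
      have := Nat.mul_pos hN (ih (by omega))
      omega
  obtain ⟨S', hS'⟩ := Finset.card_pos.1 (hpos N le_rfl)
  obtain ⟨hS'N, hS'k⟩ := mem_sparseSets.1 hS'
  exact ⟨S', hS'N, fun S hS => by exact_mod_cast hS'k S hS⟩
end

section
/- For every integer M ≥ 1, one has c(M²) ≤ c(M)², where for each N ≥ 1, c(N) denotes the minimum, over all N-element subsets S' of the set of grid squares {Q_{i,j}^N : 0 ≤ i,j < N}, of the maximum over all affine lines ℓ ⊆ ℝ² of the number of squares Q ∈ S' with Q ∩ ℓ ≠ ∅. -/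
open scoped Classical

/-- The closed grid square `Q_{i,j}^N = [i/N, (i+1)/N] × [j/N, (j+1)/N]` in `ℝ²`. -/
def gridSquare (N i j : ℕ) : Set (ℝ × ℝ) :=
  Set.Icc ((i : ℝ) / N) ((i + 1 : ℝ) / N) ×ˢ Set.Icc ((j : ℝ) / N) ((j + 1 : ℝ) / N)

/-- `ℓ` is an affine line in `ℝ²`. -/
def IsLine (ℓ : Set (ℝ × ℝ)) : Prop :=
  ∃ p v : ℝ × ℝ, v ≠ 0 ∧ ℓ = {x | ∃ t : ℝ, x = p + t • v}

/-- `occupancy N` is `c(N)` : the minimum over selections `S'` of `N` of the `N²` grid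
squares of side `1/N` of the maximal number of selected squares met by a single affine
line. It is phrased as the least `κ` for which some `N`-element selection meets every
line in at most `κ` squares. -/
noncomputable def occupancy (N : ℕ) : ℕ :=
  sInf {κ | ∃ S' : Finset (Fin N × Fin N), S'.card = N ∧
    ∀ ℓ : Set (ℝ × ℝ), IsLine ℓ →
      (S'.filter (fun q => (gridSquare N q.1 q.2 ∩ ℓ).Nonempty)).card ≤ κ}

/-- The infimum defining `occupancy N` is attained. -/
theorem exists_selection_occupancy (N : ℕ) :
    ∃ S' : Finset (Fin N × Fin N), S'.card = N ∧
      ∀ ℓ : Set (ℝ × ℝ), IsLine ℓ →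
        (S'.filter (fun q => (gridSquare N q.1 q.2 ∩ ℓ).Nonempty)).card ≤ occupancy N := by
  refine Nat.sInf_mem (s := {κ | ∃ S' : Finset (Fin N × Fin N), S'.card = N ∧
    ∀ ℓ : Set (ℝ × ℝ), IsLine ℓ →
      (S'.filter (fun q => (gridSquare N q.1 q.2 ∩ ℓ).Nonempty)).card ≤ κ})
    ⟨N, Finset.univ.image fun i => (i, i), ?_, fun ℓ _ => ?_⟩
  · rw [Finset.card_image_of_injective _ fun a b h => congrArg Prod.fst h, Finset.card_fin]
  · refine (Finset.card_filter_le _ _).trans (Finset.card_image_le.trans ?_)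
    rw [Finset.card_fin]

/-- Rescaling and translating a line gives a line. -/
theorem IsLine.image_smul_sub {ℓ : Set (ℝ × ℝ)} (hℓ : IsLine ℓ) {c : ℝ} (hc : c ≠ 0)
    (a : ℝ × ℝ) : IsLine ((fun x => c • x - a) '' ℓ) := by
  obtain ⟨p, v, hv, rfl⟩ := hℓ
  refine ⟨c • p - a, c • v, smul_ne_zero hc hv, Set.ext fun x => ?_⟩
  have key (t : ℝ) : c • (p + t • v) - a = c • p - a + t • c • v := by
    rw [smul_add, smul_comm c t v]; abel
  constructor
  · rintro ⟨_, ⟨t, rfl⟩, rfl⟩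
    exact ⟨t, key t⟩
  · rintro ⟨t, rfl⟩
    exact ⟨_, ⟨t, rfl⟩, key t⟩

/-- A cell of the refined interval subdivision lies in the coarse cell containing it. -/
theorem Icc_refined_subset {M N a b : ℕ} (hM : 0 < M) (hN : 0 < N) (hb : b < N) {x : ℝ}
    (hx : x ∈ Set.Icc (((b + N * a : ℕ) : ℝ) / (M * N : ℕ))
      ((((b + N * a : ℕ) : ℝ) + 1) / (M * N : ℕ))) :
    x ∈ Set.Icc ((a : ℝ) / M) ((a + 1 : ℝ) / M) ∧
      M * x - a ∈ Set.Icc ((b : ℝ) / N) ((b + 1 : ℝ) / N) := by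
  have hM' : (0 : ℝ) < M := by exact_mod_cast hM
  have hN' : (0 : ℝ) < N := by exact_mod_cast hN
  have hb' : (b : ℝ) + 1 ≤ N := by exact_mod_cast hb
  have hb0 : (0 : ℝ) ≤ b := b.cast_nonneg
  obtain ⟨h₁, h₂⟩ := hx
  push_cast at h₁ h₂
  rw [div_le_iff₀ (by positivity)] at h₁
  rw [le_div_iff₀ (by positivity)] at h₂
  refine ⟨⟨?_, ?_⟩, ?_, ?_⟩
  · rw [div_le_iff₀ hM']
    refine le_of_mul_le_mul_right ?_ hN'
    linarith
  · rw [le_div_iff₀ hM']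
    refine le_of_mul_le_mul_right ?_ hN'
    linarith
  · rw [div_le_iff₀ hN']
    linarith
  · rw [le_div_iff₀ hN']
    linarith

/-- The occupancy is submultiplicative. -/
theorem occupancy_mul_le {M N : ℕ} (hM : 0 < M) (hN : 0 < N) :
    occupancy (M * N) ≤ occupancy M * occupancy N := by
  obtain ⟨S, hS, hSℓ⟩ := exists_selection_occupancy M
  obtain ⟨T, hT, hTℓ⟩ := exists_selection_occupancy N
  let e (q : Fin M × Fin M) (r : Fin N × Fin N) : Fin (M * N) × Fin (M * N) :=
    (finProdFinEquiv (q.1, r.1), finProdFinEquiv (q.2, r.2))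
  have he : Function.Injective fun z : (Fin M × Fin M) × (Fin N × Fin N) => e z.1 z.2 := by
    rintro ⟨⟨a, b⟩, c, d⟩ ⟨⟨a', b'⟩, c', d'⟩ h
    simp only [e, Prod.mk.injEq, EmbeddingLike.apply_eq_iff_eq] at h ⊢
    tauto
  refine Nat.sInf_le ⟨(S ×ˢ T).image fun z => e z.1 z.2, ?_, fun ℓ hℓ => ?_⟩
  · rw [Finset.card_image_of_injective _ he, Finset.card_product, hS, hT]
  let A := S.filter fun q => (gridSquare M q.1 q.2 ∩ ℓ).Nonempty
  let φ (q : Fin M × Fin M) (x : ℝ × ℝ) : ℝ × ℝ := (M : ℝ) • x - (((q.1 : ℕ) : ℝ), ((q.2 : ℕ) : ℝ))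
  let B (q : Fin M × Fin M) := T.filter fun r => (gridSquare N r.1 r.2 ∩ φ q '' ℓ).Nonempty
  have hsub : ((S ×ˢ T).image fun z => e z.1 z.2).filter
      (fun q => (gridSquare (M * N) q.1 q.2 ∩ ℓ).Nonempty) ⊆
      A.biUnion fun q => (B q).image (e q) := by
    intro w hw
    obtain ⟨hw, x, ⟨hx₁, hx₂⟩, hxℓ⟩ := Finset.mem_filter.1 hw
    obtain ⟨⟨q, r⟩, hqr, rfl⟩ := Finset.mem_image.1 hw
    obtain ⟨hq, hr⟩ := Finset.mem_product.1 hqr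
    obtain ⟨h₁, h₁'⟩ := Icc_refined_subset hM hN r.1.isLt hx₁
    obtain ⟨h₂, h₂'⟩ := Icc_refined_subset hM hN r.2.isLt hx₂
    refine Finset.mem_biUnion.2 ⟨q, Finset.mem_filter.2 ⟨hq, x, ⟨h₁, h₂⟩, hxℓ⟩,
      Finset.mem_image.2 ⟨r, Finset.mem_filter.2 ⟨hr, φ q x, ⟨h₁', h₂'⟩, x, hxℓ, rfl⟩, rfl⟩⟩
  refine (Finset.card_le_card hsub).trans ((Finset.card_biUnion_le_card_mul _ _ (occupancy N)
    fun q _ => Finset.card_image_le.trans (hTℓ _ (hℓ.image_smul_sub ?_ _))).trans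
    (Nat.mul_le_mul_right _ (hSℓ ℓ hℓ)))
  exact_mod_cast hM.ne'

/-- self-similarity inequality `c(M²) ≤ c(M)²`. -/
theorem stmt11 (M : ℕ) (hM : 1 ≤ M) : occupancy (M ^ 2) ≤ occupancy M ^ 2 := by
  rw [sq, sq]
  exact occupancy_mul_le hM hM
end

section
/- There is an absolute constant C > 0, and for each c ∈ (0,1] a constant c' > 0, such that: (i) for every integer N ≥ 2 and every subset S ⊆ {1, …, N}, one has Σ_{n,m ∈ S, n ≠ m} 1/|n − m| ≤ C·N·log N; and (ii) for every c ∈ (0,1], every integer N ≥ 2/c, and every subset S ⊆ {1, …, N} with |S| ≥ c·N, one has Σ_{n,m ∈ S, n ≠ m} 1/|n − m| ≥ c'·N·log N. -/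
open Finset in
/-- The increasing enumeration of a finite set of naturals. -/
lemma Finset.exists_strictMonoOn_image_range (S : Finset ℕ) :
    ∃ f : ℕ → ℕ, StrictMonoOn f (Set.Iio #S) ∧ (range #S).image f = S := by
  have hfin : (Set.ofPred (· ∈ S)).Finite := S.finite_toSet
  have hS : hfin.toFinset = S := by ext; simp
  refine ⟨Nat.nth (· ∈ S), ?_, ?_⟩
  · have := Nat.nth_strictMonoOn hfin
    rwa [hS] at this
  · have := Nat.image_nth_Iio_card hfin
    rw [hS] at this
    apply Finset.coe_injective
    rw [Finset.coe_image, Finset.coe_range, this]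
    rfl

lemma harmonic_cast_eq_sum_Icc (n : ℕ) :
    (harmonic n : ℝ) = ∑ d ∈ Finset.Icc 1 n, 1 / (d : ℝ) := by
  rw [harmonic_eq_sum_Icc]
  push_cast
  simp

/-- If the distances from `n` to the points of `T` are distinct elements of `{1, …, N}`, then their
reciprocals sum to at most `harmonic N`. -/
lemma sum_one_div_abs_sub_le_harmonic {N n : ℕ} {T : Finset ℕ}
    (hinj : Set.InjOn (fun m : ℕ => ((n : ℤ) - m).natAbs) T)
    (hT : ∀ m ∈ T, ((n : ℤ) - m).natAbs ∈ Finset.Icc 1 N) :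
    ∑ m ∈ T, 1 / |(n : ℝ) - (m : ℝ)| ≤ harmonic N := by
  have hcast : ∀ m ∈ T, 1 / |(n : ℝ) - (m : ℝ)| = 1 / ((((n : ℤ) - m).natAbs : ℕ) : ℝ) := by
    intro m _
    rw [Nat.cast_natAbs]
    push_cast
    rfl
  rw [harmonic_cast_eq_sum_Icc, Finset.sum_congr rfl hcast,
    ← Finset.sum_image (f := fun d : ℕ => 1 / (d : ℝ)) hinj]
  refine Finset.sum_le_sum_of_subset_of_nonneg (Finset.image_subset_iff.2 hT) ?_
  intros
  positivity

lemma sum_sdiff_one_div_abs_sub_le {N n : ℕ} {S : Finset ℕ} (hS : S ⊆ Finset.Icc 1 N)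
    (hn : n ∈ S) :
    ∑ m ∈ S \ {n}, 1 / |(n : ℝ) - (m : ℝ)| ≤ 2 * (1 + Real.log N) := by
  have hbd : ∀ m ∈ S, 1 ≤ m ∧ m ≤ N := fun m hm => Finset.mem_Icc.1 (hS hm)
  have hn' := hbd n hn
  have hH := harmonic_le_one_add_log N
  have h1 : ∑ m ∈ (S \ {n}).filter (· < n), 1 / |(n : ℝ) - (m : ℝ)| ≤ harmonic N := by
    apply sum_one_div_abs_sub_le_harmonic
    · intro a ha b hb hab
      simp only [Finset.coe_filter, Set.mem_ofPred_eq] at ha hb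
      dsimp only at hab
      omega
    · intro m hm
      simp only [Finset.mem_filter, Finset.mem_sdiff, Finset.mem_singleton] at hm
      have := hbd m hm.1.1
      rw [Finset.mem_Icc]
      omega
  have h2 : ∑ m ∈ (S \ {n}).filter (¬ · < n), 1 / |(n : ℝ) - (m : ℝ)| ≤ harmonic N := by
    apply sum_one_div_abs_sub_le_harmonic
    · intro a ha b hb hab
      simp only [Finset.coe_filter, Set.mem_ofPred_eq] at ha hb
      dsimp only at hab
      omega
    · intro m hm
      simp only [Finset.mem_filter, Finset.mem_sdiff, Finset.mem_singleton] at hm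
      have := hbd m hm.1.1
      rw [Finset.mem_Icc]
      omega
  rw [← Finset.sum_filter_add_sum_filter_not _ (· < n)]
  linarith

/-- The gaps `f (i + j) - f i` of a sequence with values in `[0, N]` telescope. -/
lemma sum_range_shift_sub_le {f : ℕ → ℝ} {N : ℝ} {K j : ℕ} (hj : j ≤ K)
    (hf : ∀ i < K, 0 ≤ f i ∧ f i ≤ N) :
    ∑ i ∈ Finset.range (K - j), (f (i + j) - f i) ≤ j * N := by
  obtain ⟨r, rfl⟩ := Nat.exists_eq_add_of_le hj
  have h1 := Finset.sum_range_add f j r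
  have h2 := Finset.sum_range_add f r j
  rw [add_comm r j] at h2
  have h3 : 0 ≤ ∑ i ∈ Finset.range j, f i := by
    refine Finset.sum_nonneg fun i hi => (hf i ?_).1
    have := Finset.mem_range.1 hi
    omega
  have h4 : ∑ i ∈ Finset.range j, f (r + i) ≤ j * N := by
    have := Finset.sum_le_card_nsmul (Finset.range j) (fun i => f (r + i)) N (fun i hi => by
      have := Finset.mem_range.1 hi
      exact (hf _ (by omega)).2)
    simpa using this
  rw [Nat.add_sub_cancel_left, Finset.sum_sub_distrib]
  simp only [add_comm _ j]
  linarith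

lemma sq_div_le_sum_one_div_shift_sub {f : ℕ → ℝ} {N : ℝ} {K j : ℕ} (hj1 : 1 ≤ j) (hj : 2 * j ≤ K)
    (hmono : StrictMonoOn f (Set.Iio K)) (hf : ∀ i < K, 0 ≤ f i ∧ f i ≤ N) :
    (K : ℝ) ^ 2 / (4 * N) * (1 / j) ≤ ∑ i ∈ Finset.range (K - j), 1 / (f (i + j) - f i) := by
  have hpos : ∀ i ∈ Finset.range (K - j), 0 < f (i + j) - f i := by
    intro i hi
    have := Finset.mem_range.1 hi
    exact sub_pos.2 (hmono (Set.mem_Iio.2 (by omega)) (Set.mem_Iio.2 (by omega)) (by omega))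
  have hcs := Finset.sq_sum_div_le_sum_sq_div (Finset.range (K - j)) (fun _ => (1 : ℝ)) hpos
  have htel := sum_range_shift_sub_le (by omega : j ≤ K) hf
  have hsum : 0 < ∑ i ∈ Finset.range (K - j), (f (i + j) - f i) :=
    Finset.sum_pos hpos ⟨0, Finset.mem_range.2 (by omega)⟩
  simp only [one_pow, Finset.sum_const, Finset.card_range, nsmul_eq_mul, mul_one] at hcs
  have hcard : (K : ℝ) / 2 ≤ ((K - j : ℕ) : ℝ) := by
    rw [Nat.cast_sub (by omega)]
    have : (2 * j : ℝ) ≤ K := by exact_mod_cast hj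
    linarith
  calc (K : ℝ) ^ 2 / (4 * N) * (1 / j) = ((K : ℝ) / 2) ^ 2 / (j * N) := by
        rw [div_mul_div_comm, div_pow, div_div]
        congr 1 <;> ring
    _ ≤ ((K - j : ℕ) : ℝ) ^ 2 / ∑ i ∈ Finset.range (K - j), (f (i + j) - f i) := by gcongr
    _ ≤ _ := hcs

lemma sq_card_div_mul_harmonic_le {N : ℕ} {S : Finset ℕ} (hS : S ⊆ Finset.Icc 1 N) :
    (S.card : ℝ) ^ 2 / (4 * N) * harmonic (S.card / 2)
      ≤ ∑ n ∈ S, ∑ m ∈ S \ {n}, 1 / |(n : ℝ) - (m : ℝ)| := by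
  obtain ⟨f, hmono, himg⟩ := S.exists_strictMonoOn_image_range
  set K := S.card
  have hmem : ∀ i < K, f i ∈ S := fun i hi => by
    rw [← himg]
    exact Finset.mem_image_of_mem _ (Finset.mem_range.2 hi)
  have hrow : ∀ i ∈ Finset.range K,
      ∑ j ∈ (Finset.Icc 1 (K / 2)).filter (fun j => i + j < K), 1 / ((f (i + j) : ℝ) - f i)
        ≤ ∑ m ∈ S \ {f i}, 1 / |(f i : ℝ) - m| := by
    intro i hi
    have hi := Finset.mem_range.1 hi
    have hlt : ∀ j ∈ (Finset.Icc 1 (K / 2)).filter (fun j => i + j < K), f i < f (i + j) := by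
      intro j hj
      simp only [Finset.mem_filter, Finset.mem_Icc] at hj
      exact hmono (Set.mem_Iio.2 hi) (Set.mem_Iio.2 hj.2) (by omega)
    have hinj : Set.InjOn (fun j => f (i + j))
        ((Finset.Icc 1 (K / 2)).filter (fun j => i + j < K) : Finset ℕ) := by
      intro a ha b hb hab
      simp only [Finset.coe_filter, Set.mem_ofPred_eq] at ha hb
      have := hmono.injOn (Set.mem_Iio.2 ha.2) (Set.mem_Iio.2 hb.2) hab
      omega
    calc _ = ∑ j ∈ (Finset.Icc 1 (K / 2)).filter (fun j => i + j < K),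
            1 / |(f i : ℝ) - (f (i + j) : ℕ)| := by
          refine Finset.sum_congr rfl fun j hj => ?_
          have : (f i : ℝ) < f (i + j) := by exact_mod_cast hlt j hj
          rw [abs_sub_comm, abs_of_pos (sub_pos.2 this)]
      _ = _ := (Finset.sum_image (f := fun m : ℕ => 1 / |(f i : ℝ) - m|) hinj).symm
      _ ≤ _ := by
          refine Finset.sum_le_sum_of_subset_of_nonneg (Finset.image_subset_iff.2 fun j hj => ?_)
            fun _ _ _ => by positivity
          rw [Finset.mem_sdiff, Finset.mem_singleton]
          exact ⟨hmem _ (Finset.mem_filter.1 hj).2, (hlt j hj).ne'⟩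
  have hmonoR : StrictMonoOn (fun i => (f i : ℝ)) (Set.Iio K) :=
    fun a ha b hb hab => Nat.cast_lt.2 (hmono ha hb hab)
  calc (K : ℝ) ^ 2 / (4 * N) * harmonic (K / 2)
      = ∑ j ∈ Finset.Icc 1 (K / 2), (K : ℝ) ^ 2 / (4 * N) * (1 / j) := by
        rw [harmonic_cast_eq_sum_Icc, Finset.mul_sum]
    _ ≤ ∑ j ∈ Finset.Icc 1 (K / 2), ∑ i ∈ Finset.range (K - j), 1 / ((f (i + j) : ℝ) - f i) := by
        refine Finset.sum_le_sum fun j hj => ?_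
        rw [Finset.mem_Icc] at hj
        refine sq_div_le_sum_one_div_shift_sub hj.1 (by omega) hmonoR fun i hi => ⟨by positivity, ?_⟩
        exact Nat.cast_le.2 (Finset.mem_Icc.1 (hS (hmem i hi))).2
    _ = ∑ i ∈ Finset.range K, ∑ j ∈ (Finset.Icc 1 (K / 2)).filter (fun j => i + j < K),
          1 / ((f (i + j) : ℝ) - f i) := by
        refine Finset.sum_comm' fun j i => ?_
        simp only [Finset.mem_filter, Finset.mem_Icc, Finset.mem_range]
        omega
    _ ≤ ∑ i ∈ Finset.range K, ∑ m ∈ S \ {f i}, 1 / |(f i : ℝ) - m| := Finset.sum_le_sum hrow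
    _ = ∑ n ∈ (Finset.range K).image f, ∑ m ∈ S \ {n}, 1 / |(n : ℝ) - (m : ℝ)| :=
        (Finset.sum_image (f := fun n : ℕ => ∑ m ∈ S \ {n}, 1 / |(n : ℝ) - (m : ℝ)|)
          (by simpa using hmono.injOn)).symm
    _ = _ := by rw [himg]

lemma log_le_mul_harmonic_half {c : ℝ} {N K : ℕ} (hc : 0 < c) (hc1 : c ≤ 1) (hN : 2 / c ≤ (N : ℝ))
    (hK : c * N ≤ K) : Real.log N ≤ (1 + Real.log (2 / c)) * harmonic (K / 2) := by
  have hcN : 2 ≤ c * N := by rwa [div_le_iff₀' hc] at hN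
  have hK2 : 1 ≤ K / 2 := by
    have : (2 : ℝ) ≤ K := hcN.trans hK
    have : 2 ≤ K := by exact_mod_cast this
    omega
  have hK3 : (K : ℝ) ≤ 2 * ((K / 2 + 1 : ℕ) : ℝ) := by
    have : K ≤ 2 * (K / 2 + 1) := by omega
    exact_mod_cast this
  have hone : (1 : ℝ) ≤ harmonic (K / 2) := by
    rw [harmonic_cast_eq_sum_Icc]
    have := Finset.single_le_sum (f := fun d : ℕ => 1 / (d : ℝ)) (s := Finset.Icc 1 (K / 2))
      (fun _ _ => by positivity) (Finset.mem_Icc.2 ⟨le_rfl, hK2⟩)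
    simpa using this
  have hlog : Real.log (c * N / 2) ≤ harmonic (K / 2) :=
    (Real.log_le_log (by linarith) (by linarith)).trans (log_add_one_le_harmonic (K / 2))
  have hsplit : Real.log N = Real.log (c * N / 2) + Real.log (2 / c) := by
    rw [← Real.log_mul (by linarith) (by positivity)]
    congr 1
    field_simp
  have hlog0 : 0 ≤ Real.log (2 / c) := Real.log_nonneg (by rw [le_div_iff₀ hc]; linarith)
  nlinarith


/-- There is an absolute constant `C > 0`, and for each `c ∈ (0,1]` a
constant `c' > 0`, such that: (i) for every `N ≥ 2` and every `S ⊆ {1,…,N}`,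
`Σ_{n≠m∈S} 1/|n−m| ≤ C·N·log N`; and (ii) for every `c ∈ (0,1]`, every `N ≥ 2/c` and
every `S ⊆ {1,…,N}` with `|S| ≥ c·N`, `Σ_{n≠m∈S} 1/|n−m| ≥ c'·N·log N`. -/
theorem stmt13 :
    ∃ C : ℝ, 0 < C ∧
      (∀ N : ℕ, 2 ≤ N → ∀ S : Finset ℕ, S ⊆ Finset.Icc 1 N →
        ∑ n ∈ S, ∑ m ∈ S \ {n}, 1 / |(n : ℝ) - (m : ℝ)| ≤ C * N * Real.log N) ∧
      ∀ c : ℝ, 0 < c → c ≤ 1 →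
        ∃ c' : ℝ, 0 < c' ∧
          ∀ N : ℕ, 2 / c ≤ (N : ℝ) → ∀ S : Finset ℕ, S ⊆ Finset.Icc 1 N →
            c * N ≤ (S.card : ℝ) →
            c' * N * Real.log N ≤ ∑ n ∈ S, ∑ m ∈ S \ {n}, 1 / |(n : ℝ) - (m : ℝ)| := by
  refine ⟨8, by norm_num, fun N hN S hS => ?_, fun c hc hc1 => ?_⟩
  · have hlog : 1 / 2 ≤ Real.log N := by
      have := Real.log_le_log (by norm_num) (show (2 : ℝ) ≤ N by exact_mod_cast hN)
      linarith [Real.log_two_gt_d9]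
    have hcard : (S.card : ℝ) ≤ N := by
      exact_mod_cast (Finset.card_le_card hS).trans_eq (by simp)
    calc ∑ n ∈ S, ∑ m ∈ S \ {n}, 1 / |(n : ℝ) - (m : ℝ)|
        ≤ ∑ n ∈ S, 2 * (1 + Real.log N) :=
          Finset.sum_le_sum fun n hn => sum_sdiff_one_div_abs_sub_le hS hn
      _ = S.card * (2 * (1 + Real.log N)) := by rw [Finset.sum_const, nsmul_eq_mul]
      _ ≤ N * (8 * Real.log N) := mul_le_mul hcard (by linarith) (by linarith) (by positivity)
      _ = 8 * N * Real.log N := by ring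
  · have hlog0 : 0 ≤ Real.log (2 / c) := Real.log_nonneg (by rw [le_div_iff₀ hc]; linarith)
    refine ⟨c ^ 2 / (4 * (1 + Real.log (2 / c))), by positivity, fun N hN S hS hcard => ?_⟩
    have hNpos : (0 : ℝ) < N := (by positivity : 0 < 2 / c).trans_le hN
    have hH : (0 : ℝ) ≤ harmonic (S.card / 2) := by
      rw [harmonic_cast_eq_sum_Icc]
      positivity
    calc c ^ 2 / (4 * (1 + Real.log (2 / c))) * N * Real.log N
        ≤ c ^ 2 / (4 * (1 + Real.log (2 / c))) * N *
            ((1 + Real.log (2 / c)) * harmonic (S.card / 2)) := by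
          gcongr
          exact log_le_mul_harmonic_half hc hc1 hN hcard
      _ = (c * N) ^ 2 / (4 * N) * harmonic (S.card / 2) := by field_simp
      _ ≤ (S.card : ℝ) ^ 2 / (4 * N) * harmonic (S.card / 2) := by gcongr
      _ ≤ _ := sq_card_div_mul_harmonic_le hS
end

section
/- For every irrational real number θ and every integer N ≥ 1, there exists an affine line ℓ ⊆ ℝ² that contains at least ⌊√N⌋ of the points (n, {nθ}) with n ∈ {1, …, N}, where {x} = x − ⌊x⌋ denotes the fractional part. -/
open scoped Classical

/-- If `x` is within `1 / (s + 1)` of an integer, the fractional parts of `x, 2x, …, sx` lie in an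
arithmetic progression. -/
theorem exists_fract_mul_eq_add_mul_sub (x : ℝ) (j : ℤ) (s : ℕ)
    (hx : |x - j| ≤ 1 / ((s : ℝ) + 1)) :
    ∃ c : ℝ, ∀ l ∈ Finset.Icc 1 s, Int.fract ((l : ℝ) * x) = c + l * (x - j) := by
  have hs : (0 : ℝ) < (s : ℝ) + 1 := by positivity
  rw [le_div_iff₀ hs] at hx
  rcases le_or_gt 0 (x - j) with hδ | hδ
  · rw [abs_of_nonneg hδ] at hx
    refine ⟨0, fun l hl => Int.fract_eq_iff.2 ⟨by positivity, ?_, l * j, by push_cast; ring⟩⟩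
    have hl' : (l : ℝ) ≤ s := by exact_mod_cast (Finset.mem_Icc.1 hl).2
    rcases hδ.eq_or_lt with h | h
    · simp [← h]
    · nlinarith
  · rw [abs_of_neg hδ] at hx
    refine ⟨1, fun l hl => Int.fract_eq_iff.2 ⟨?_, ?_, l * j - 1, by push_cast; ring⟩⟩
    · have hl' : (l : ℝ) ≤ s := by exact_mod_cast (Finset.mem_Icc.1 hl).2
      nlinarith
    · have hl' : (1 : ℝ) ≤ l := by exact_mod_cast (Finset.mem_Icc.1 hl).1
      nlinarith

/-- For every irrational `θ` and every `N ≥ 1`, some affine line in `ℝ²`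
contains at least `⌊√N⌋` of the points `(n, {nθ})`, `n ∈ {1,…,N}`. -/
theorem stmt16 (θ : ℝ) (hθ : Irrational θ) (N : ℕ) (hN : 1 ≤ N) :
    ∃ ℓ : Set (ℝ × ℝ), IsLine ℓ ∧
      Nat.sqrt N ≤
        ((Finset.Icc 1 N).filter
          (fun n : ℕ => ((n : ℝ), Int.fract ((n : ℝ) * θ)) ∈ ℓ)).card := by
  obtain ⟨p, hp, hps, hδ⟩ := Real.exists_nat_abs_mul_sub_round_le θ (Nat.sqrt_pos.2 hN)
  obtain ⟨c, hc⟩ := exists_fract_mul_eq_add_mul_sub _ _ _ hδ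
  refine ⟨_, ⟨(0, c), ((p : ℝ), p * θ - round (p * θ)), ?_, rfl⟩, ?_⟩
  · intro h
    exact hp.ne' (Nat.cast_eq_zero.1 (congrArg Prod.fst h))
  · calc
      Nat.sqrt N = ((Finset.Icc 1 (Nat.sqrt N)).image (fun l => l * p)).card := by
        rw [Finset.card_image_of_injective _ (mul_left_injective₀ hp.ne'), Nat.card_Icc,
          Nat.add_sub_cancel]
      _ ≤ _ := by
        refine Finset.card_le_card (Finset.image_subset_iff.2 fun l hl => ?_)
        obtain ⟨hl1, hls⟩ := Finset.mem_Icc.1 hl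
        refine Finset.mem_filter.2 ⟨Finset.mem_Icc.2
          ⟨Nat.mul_pos hl1 hp, (Nat.mul_le_mul hls hps).trans (Nat.sqrt_le N)⟩, (l : ℝ), ?_⟩
        ext
        · simp
        · simpa [mul_assoc] using hc l hl
end

section
/- For every real A ≥ 1 there exists a constant c > 0 (depending only on A) such that the following holds for every integer N ≥ 2. Let P ⊆ [0,1]² be a set of N points such that for every r ∈ [1/N, 1], P can be covered by at most A/r closed balls of radius r. Then Σ_{p, q ∈ P, p ≠ q} 1/‖p − q‖ ≥ c·N²·log N. -/
open scoped Classical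

/-- The powers `2 ^ j` with `d * 2 ^ j ≤ 2` sum up to at most `4 / d`. -/
theorem sum_ite_two_pow_le {d : ℝ} (hd : 0 < d) (n : ℕ) :
    ∑ j ∈ Finset.range n, (if d * 2 ^ j ≤ 2 then (2 : ℝ) ^ j else 0) ≤ 4 / d := by
  induction n with
  | zero => simp; positivity
  | succ n ih =>
    by_cases h : d * 2 ^ n ≤ 2
    · calc ∑ j ∈ Finset.range (n + 1), (if d * 2 ^ j ≤ 2 then (2 : ℝ) ^ j else 0)
          ≤ ∑ j ∈ Finset.range (n + 1), (2 : ℝ) ^ j := by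
            refine Finset.sum_le_sum fun j _ => ?_
            split_ifs
            · exact le_rfl
            · positivity
        _ ≤ 2 ^ (n + 1) := by
            rw [geom_sum_eq (by norm_num)]
            norm_num
        _ ≤ 4 / d := by
            rw [le_div_iff₀ hd, pow_succ]
            linarith
    · rw [Finset.sum_range_succ, if_neg h, add_zero]
      exact ih

/-- If `P` is covered by the closed balls of radius `r` centered at `Z`, then at least
`P.card ^ 2 / Z.card` ordered pairs of points of `P` are at distance at most `2 * r`. -/
theorem card_sq_le_card_mul_sum_ite {E : Type*} [SeminormedAddCommGroup E] {P Z : Finset E}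
    {r : ℝ} (h : (P : Set E) ⊆ ⋃ z ∈ Z, Metric.closedBall z r) :
    (P.card : ℝ) ^ 2 ≤
      Z.card * ∑ p ∈ P, ∑ q ∈ P, (if ‖p - q‖ ≤ 2 * r then (1 : ℝ) else 0) := by
  have h' : ∀ p : E, ∃ z, p ∈ P → z ∈ Z ∧ dist p z ≤ r := by
    intro p
    by_cases hp : p ∈ P
    · have := h hp
      simp only [Set.mem_iUnion, Metric.mem_closedBall] at this
      obtain ⟨z, hz, hpz⟩ := this
      exact ⟨z, fun _ => ⟨hz, hpz⟩⟩
    · exact ⟨0, fun h => absurd h hp⟩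
  choose f hf using h'
  have hcard : (P.card : ℝ) = ∑ z ∈ Z, ((P.filter fun p => f p = z).card : ℝ) := by
    exact_mod_cast Finset.card_eq_sum_card_fiberwise fun p hp => (hf p hp).1
  calc (P.card : ℝ) ^ 2 = (∑ z ∈ Z, ((P.filter fun p => f p = z).card : ℝ)) ^ 2 := by rw [hcard]
    _ ≤ Z.card * ∑ z ∈ Z, ((P.filter fun p => f p = z).card : ℝ) ^ 2 := sq_sum_le_card_mul_sum_sq
    _ ≤ _ := by
      gcongr
      calc ∑ z ∈ Z, ((P.filter fun p => f p = z).card : ℝ) ^ 2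
          = ∑ z ∈ Z, ∑ p ∈ P, ∑ q ∈ P,
              (if f p = z then (1 : ℝ) else 0) * (if f q = z then 1 else 0) := by
            refine Finset.sum_congr rfl fun z _ => ?_
            rw [← Finset.sum_mul_sum, Finset.sum_boole, sq]
        _ = ∑ p ∈ P, ∑ q ∈ P, ∑ z ∈ Z,
              (if f p = z then (1 : ℝ) else 0) * (if f q = z then 1 else 0) := by
            rw [Finset.sum_comm]
            exact Finset.sum_congr rfl fun p _ => Finset.sum_comm
        _ ≤ _ := by
            refine Finset.sum_le_sum fun p hp => Finset.sum_le_sum fun q hq => ?_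
            simp only [ite_mul, one_mul, zero_mul, Finset.sum_ite_eq, (hf p hp).1, if_true]
            by_cases hpq : f q = f p
            · have h1 := (hf p hp).2
              have h2 := (hf q hq).2
              rw [hpq] at h2
              have h3 : ‖p - q‖ ≤ 2 * r := by
                rw [← dist_eq_norm]
                linarith [dist_triangle_right p q (f p)]
              rw [if_pos hpq, if_pos h3]
            · rw [if_neg hpq]
              split_ifs <;> norm_num

/-- A set covered by at most `A / r` balls of radius `r` has many pairs of distinct points at
distance at most `2 * r`, as soon as `r * P.card ≥ 2 * A`. -/
theorem le_sum_sdiff_ite {E : Type*} [SeminormedAddCommGroup E] [DecidableEq E]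
    {P Z : Finset E} {A r : ℝ}
    (hA : 0 < A) (hr : 0 < r) (hZ : (Z.card : ℝ) ≤ A / r) (hrP : 2 * A ≤ r * P.card)
    (h : (P : Set E) ⊆ ⋃ z ∈ Z, Metric.closedBall z r) :
    r * (P.card : ℝ) ^ 2 / (2 * A) ≤
      ∑ p ∈ P, ∑ q ∈ P \ {p}, (if ‖p - q‖ ≤ 2 * r then (1 : ℝ) else 0) := by
  have hsplit : ∑ p ∈ P, ∑ q ∈ P, (if ‖p - q‖ ≤ 2 * r then (1 : ℝ) else 0) =
      P.card + ∑ p ∈ P, ∑ q ∈ P \ {p}, (if ‖p - q‖ ≤ 2 * r then (1 : ℝ) else 0) := by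
    rw [Finset.card_eq_sum_ones, Nat.cast_sum, ← Finset.sum_add_distrib]
    refine Finset.sum_congr rfl fun p hp => ?_
    rw [← Finset.sum_sdiff (Finset.singleton_subset_iff.2 hp), Finset.sum_singleton, sub_self,
      norm_zero, if_pos (by positivity), Nat.cast_one, add_comm]
  have key := card_sq_le_card_mul_sum_ite h
  rw [hsplit] at key
  set S := ∑ p ∈ P, ∑ q ∈ P \ {p}, (if ‖p - q‖ ≤ 2 * r then (1 : ℝ) else 0)
  have hS : 0 ≤ S := Finset.sum_nonneg fun p _ => Finset.sum_nonneg fun q _ => by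
    split_ifs <;> norm_num
  have h1 : (P.card : ℝ) ^ 2 ≤ A / r * (P.card + S) := key.trans (by gcongr)
  have h2 : r * (P.card : ℝ) ^ 2 ≤ A * (P.card + S) := by
    rw [div_mul_eq_mul_div, le_div_iff₀ hr] at h1
    linarith
  have h3 := mul_le_mul_of_nonneg_right hrP (Nat.cast_nonneg (α := ℝ) P.card)
  rw [div_le_iff₀ (by positivity)]
  nlinarith

/-- Points of the unit square are at distance at most `2`. -/
theorem norm_sub_le_two_of_mem_unitSquare {p q : EuclideanSpace ℝ (Fin 2)}
    (hp : ∀ i, p i ∈ Set.Icc (0 : ℝ) 1) (hq : ∀ i, q i ∈ Set.Icc (0 : ℝ) 1) : ‖p - q‖ ≤ 2 := by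
  have h : ∀ i, (p i - q i) ^ 2 ≤ 1 := fun i => by
    rw [sq_le_one_iff_abs_le_one, abs_le]
    constructor <;> linarith [(hp i).1, (hp i).2, (hq i).1, (hq i).2]
  rw [EuclideanSpace.norm_eq, Real.sqrt_le_left (by norm_num), Fin.sum_univ_two]
  simp only [PiLp.sub_apply, Real.norm_eq_abs, sq_abs]
  linarith [h 0, h 1]

/-- The dyadic lower bound for the sum of inverse distances, from pair counts at the scales
`2 * (1 / 2) ^ j` for `j < n`. -/
theorem nat_mul_le_sum_inv_norm_sub {E : Type*} [NormedAddCommGroup E] [DecidableEq E]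
    {P : Finset E} {C : ℝ}
    (n : ℕ) (h : ∀ j < n, C / 2 ^ j ≤
      ∑ p ∈ P, ∑ q ∈ P \ {p}, (if ‖p - q‖ ≤ 2 * (1 / 2 ^ j) then (1 : ℝ) else 0)) :
    n * C ≤ 4 * ∑ p ∈ P, ∑ q ∈ P \ {p}, 1 / ‖p - q‖ := by
  calc n * C = ∑ j ∈ Finset.range n, C := by simp
    _ ≤ ∑ j ∈ Finset.range n, ∑ p ∈ P, ∑ q ∈ P \ {p},
          (if ‖p - q‖ * 2 ^ j ≤ 2 then (2 : ℝ) ^ j else 0) := by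
        refine Finset.sum_le_sum fun j hj => ?_
        have hpos : (0 : ℝ) < 2 ^ j := by positivity
        have hj := h j (Finset.mem_range.1 hj)
        rw [div_le_iff₀ hpos] at hj
        refine hj.trans_eq ?_
        simp only [Finset.sum_mul, ite_mul, one_mul, zero_mul, mul_one_div, le_div_iff₀ hpos]
    _ = ∑ p ∈ P, ∑ q ∈ P \ {p}, ∑ j ∈ Finset.range n,
          (if ‖p - q‖ * 2 ^ j ≤ 2 then (2 : ℝ) ^ j else 0) := by
        rw [Finset.sum_comm]
        exact Finset.sum_congr rfl fun p _ => Finset.sum_comm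
    _ ≤ ∑ p ∈ P, ∑ q ∈ P \ {p}, 4 / ‖p - q‖ := by
        refine Finset.sum_le_sum fun p _ => Finset.sum_le_sum fun q hq => ?_
        refine sum_ite_two_pow_le (norm_pos_iff.2 (sub_ne_zero.2 ?_)) n
        rintro rfl
        simp at hq
    _ = _ := by simp only [Finset.mul_sum, mul_one_div]

/-- For every `A ≥ 1` there is `c > 0` such that for every `N ≥ 2` and
every set `P` of `N` points of `[0,1]²` which, for every `r ∈ [1/N, 1]`, can be covered
by at most `A/r` closed balls of radius `r`, one has
`Σ_{p ≠ q ∈ P} 1/‖p − q‖ ≥ c·N²·log N`. -/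
theorem stmt18 (A : ℝ) (hA : 1 ≤ A) :
    ∃ c : ℝ, 0 < c ∧
      ∀ N : ℕ, 2 ≤ N →
        ∀ P : Finset (EuclideanSpace ℝ (Fin 2)),
          P.card = N →
          (∀ p ∈ P, ∀ i : Fin 2, p i ∈ Set.Icc (0 : ℝ) 1) →
          (∀ r : ℝ, 1 / N ≤ r → r ≤ 1 →
            ∃ Z : Finset (EuclideanSpace ℝ (Fin 2)), (Z.card : ℝ) ≤ A / r ∧
              ↑P ⊆ ⋃ z ∈ Z, Metric.closedBall z r) →
          c * N ^ 2 * Real.log N ≤ ∑ p ∈ P, ∑ q ∈ P \ {p}, 1 / ‖p - q‖ := by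
  refine ⟨1 / (16 * A), by positivity, fun N hN P hP hsq hcov => ?_⟩
  set S := ∑ p ∈ P, ∑ q ∈ P \ {p}, 1 / ‖p - q‖ with hS
  have hN' : (2 : ℝ) ≤ N := by exact_mod_cast hN
  have htriv : (N : ℝ) ^ 2 ≤ 4 * S := by
    have h : ∑ p ∈ P, ∑ q ∈ P \ {p}, (1 / 2 : ℝ) ≤ S := by
      refine Finset.sum_le_sum fun p hp => Finset.sum_le_sum fun q hq => ?_
      rw [Finset.mem_sdiff, Finset.mem_singleton] at hq
      exact one_div_le_one_div_of_le (norm_pos_iff.2 (sub_ne_zero.2 (Ne.symm hq.2)))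
        (norm_sub_le_two_of_mem_unitSquare (hsq p hp) (hsq q hq.1))
    have hcard : ∀ p ∈ P, ∑ q ∈ P \ {p}, (1 / 2 : ℝ) = (N - 1) * (1 / 2) := fun p hp => by
      rw [Finset.sum_const, Finset.card_sdiff_of_subset (Finset.singleton_subset_iff.2 hp), hP,
        Finset.card_singleton, nsmul_eq_mul, Nat.cast_sub (by lia), Nat.cast_one]
    rw [Finset.sum_congr rfl hcard, Finset.sum_const, hP, nsmul_eq_mul] at h
    nlinarith
  have hlog : (N : ℝ) ^ 2 * (Real.log N - Real.log (2 * A)) ≤ 8 * A * S := by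
    rw [← Real.log_div (by positivity) (by positivity)]
    rcases le_or_gt (2 * A) N with hAN | hAN
    · obtain ⟨n, hn, hn'⟩ := exists_nat_pow_near ((one_le_div (by positivity)).2 hAN) one_lt_two
      have hle : Real.log (N / (2 * A)) ≤ (n + 1 : ℕ) := by
        calc Real.log (N / (2 * A)) ≤ Real.log (2 ^ (n + 1)) :=
              Real.log_le_log (by positivity) hn'.le
          _ = (n + 1 : ℕ) * Real.log 2 := Real.log_pow _ _
          _ ≤ (n + 1 : ℕ) * 1 := by
              gcongr
              linarith [Real.log_two_lt_d9]
          _ = _ := mul_one _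
      have hsum := nat_mul_le_sum_inv_norm_sub (P := P) (C := (N : ℝ) ^ 2 / (2 * A)) (n + 1) ?_
      · rw [← hS, ← mul_div_assoc, div_le_iff₀ (by positivity)] at hsum
        nlinarith [mul_le_mul_of_nonneg_left hle (sq_nonneg (N : ℝ))]
      · intro j hj
        have hjN : (2 : ℝ) ^ j * (2 * A) ≤ N := by
          rw [← le_div_iff₀ (by positivity)]
          exact (pow_le_pow_right₀ one_le_two (Nat.lt_succ_iff.1 hj)).trans hn
        have hj0 : (0 : ℝ) < 2 ^ j := by positivity
        obtain ⟨Z, hZ, hPZ⟩ := hcov (1 / 2 ^ j)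
          (one_div_le_one_div_of_le hj0 (by nlinarith))
          ((div_le_one hj0).2 (one_le_pow₀ one_le_two))
        have := le_sum_sdiff_ite (by positivity) (by positivity) hZ
          (by rw [hP, one_div_mul_eq_div, le_div_iff₀ hj0]; linarith) hPZ
        rw [hP] at this
        refine le_of_eq_of_le ?_ this
        field_simp
    · have : Real.log (N / (2 * A)) ≤ 0 :=
        Real.log_nonpos (by positivity) ((div_le_one (by positivity)).2 hAN.le)
      have hS0 : 0 ≤ S := by nlinarith
      exact (mul_nonpos_of_nonneg_of_nonpos (sq_nonneg _) this).trans (by positivity)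
  have hlogA : Real.log (2 * A) ≤ 2 * A := Real.log_le_self (by positivity)
  rw [one_div_mul_eq_div, div_mul_eq_mul_div, div_le_iff₀ (by positivity)]
  nlinarith [mul_le_mul_of_nonneg_left hlogA (sq_nonneg (N : ℝ)),
    mul_le_mul_of_nonneg_right htriv (by positivity : 0 ≤ 2 * A)]
end
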